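/- arXiv:2503.10590 — 4 statements merged into one kernel-verified Lean document; each statement's English description precedes it below -/
import Mathlib

section
/- 4·N_II + 4·N_IV + N_VII + 4·N_IX = 2·N̂_ℂ, i.e. 4·#{χ ∈ Irr(G) : F(χ)=1, F♯(χ)=−1} + 4·#{χ : F(χ)=0, F♯(χ)=0, χ^b=χ} + #{χ : F(χ)=0, F♯(χ)=0, χ^b≠χ} + 4·#{χ : F(χ)=−1, F♯(χ)=1} = 2·#{ψ ∈ Irr(Ĝ) : FŜ(ψ)=0}. -/
open scoped Classical

/-- `χ` is the character of an irreducible complex representation of `G`. -/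
def IsIrrChar (G : Type) [Group G] (χ : G → ℂ) : Prop :=
  ∃ V : FDRep ℂ G, CategoryTheory.Simple V ∧ χ = V.character

/-- The Frobenius–Schur indicator of a function `χ` on a finite group `G`. -/
noncomputable def FS (G : Type) [Group G] [Finite G] (χ : G → ℂ) : ℂ :=
  (∑ᶠ g : G, χ (g ^ 2)) / (Nat.card G : ℂ)

theorem conj_mem_of_index_two {Ghat : Type} [Group Ghat] {G : Subgroup Ghat} (h2 : G.index = 2)
    {g : Ghat} (hg : g ∈ G) (x : Ghat) : x * g * x⁻¹ ∈ G := by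
  rw [Subgroup.mul_mem_iff_of_index_two h2, Subgroup.mul_mem_iff_of_index_two h2]
  simp [hg, Subgroup.inv_mem_iff]

/-- The twisted Frobenius–Schur indicator, summing over the coset `Ghat \ G`. -/
noncomputable def FSsharp {Ghat : Type} [Group Ghat] [Finite Ghat] (G : Subgroup Ghat)
    (h2 : G.index = 2) (χ : ↥G → ℂ) : ℂ :=
  (∑ᶠ g ∈ {g : Ghat | g ∉ G}, χ ⟨g ^ 2, Subgroup.sq_mem_of_index_two h2 g⟩) / (Nat.card ↥G : ℂ)

/-- `χ^a`, the complex conjugate character. -/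
def aChar {G : Type} [Group G] (χ : G → ℂ) : G → ℂ := fun g => starRingEnd ℂ (χ g)

/-- `χ^b : g ↦ χ(x g x⁻¹)`. -/
def bChar {Ghat : Type} [Group Ghat] {G : Subgroup Ghat} (h2 : G.index = 2) (x : Ghat)
    (χ : ↥G → ℂ) : ↥G → ℂ :=
  fun g => χ ⟨x * ↑g * x⁻¹, conj_mem_of_index_two h2 g.2 x⟩

/-- `χ^c = conj(χ^b)`. -/
def cChar {Ghat : Type} [Group Ghat] {G : Subgroup Ghat} (h2 : G.index = 2) (x : Ghat)
    (χ : ↥G → ℂ) : ↥G → ℂ := aChar (bChar h2 x χ)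

/-- `K` is a conjugacy class of `G`. -/
def IsConjClass (G : Type) [Group G] (K : Set G) : Prop := ∃ g : G, K = {h | IsConj g h}

/-- `K^b = xKx⁻¹`. -/
def bClass {Ghat : Type} [Group Ghat] {G : Subgroup Ghat} (h2 : G.index = 2) (x : Ghat)
    (K : Set ↥G) : Set ↥G :=
  (fun g : ↥G => (⟨x * ↑g * x⁻¹, conj_mem_of_index_two h2 g.2 x⟩ : ↥G)) '' K

section CharacterTheory

variable {G : Type} [Group G]

/-- The bilinear pairing of functions on a finite group for which irreducible characters are
orthonormal. -/
noncomputable def charInner [Fintype G] (φ θ : G → ℂ) : ℂ :=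
  (Nat.card G : ℂ)⁻¹ * ∑ g : G, φ g * θ g⁻¹

/-- `φ` is the character of a complex representation of `G`. -/
def IsChar (G : Type) [Group G] (φ : G → ℂ) : Prop :=
  ∃ V : FDRep ℂ G, φ = V.character

theorem isChar_of_representation {V : Type} [AddCommGroup V] [Module ℂ V]
    [FiniteDimensional ℂ V] (ρ : Representation ℂ G V) : IsChar G ρ.character :=
  ⟨FDRep.of ρ, rfl⟩

theorem IsIrrChar.isChar {φ : G → ℂ} (h : IsIrrChar G φ) : IsChar G φ :=
  let ⟨V, _, hV⟩ := h
  ⟨V, hV⟩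

theorem IsChar.mul_comm {φ : G → ℂ} (h : IsChar G φ) (a b : G) : φ (a * b) = φ (b * a) := by
  obtain ⟨V, rfl⟩ := h
  exact V.char_mul_comm b a

theorem IsChar.conj {φ : G → ℂ} (h : IsChar G φ) (a b : G) : φ (a * b * a⁻¹) = φ b := by
  rw [h.mul_comm, inv_mul_cancel_left]

variable [Fintype G]

theorem charInner_comm (φ θ : G → ℂ) : charInner φ θ = charInner θ φ := by
  unfold charInner
  congr 1
  rw [← Equiv.sum_comp (Equiv.inv G)]
  simp [_root_.mul_comm]

theorem charInner_add_left (φ φ' θ : G → ℂ) :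
    charInner (φ + φ') θ = charInner φ θ + charInner φ' θ := by
  simp [charInner, add_mul, Finset.sum_add_distrib, mul_add]

theorem charInner_add_right (φ θ θ' : G → ℂ) :
    charInner φ (θ + θ') = charInner φ θ + charInner φ θ' := by
  rw [charInner_comm, charInner_add_left, charInner_comm θ, charInner_comm θ']

theorem charInner_representation {V W : Type} [AddCommGroup V] [Module ℂ V]
    [FiniteDimensional ℂ V] [AddCommGroup W] [Module ℂ W] [FiniteDimensional ℂ W]
    (ρ : Representation ℂ G V) (σ : Representation ℂ G W) :
    charInner σ.character ρ.character =
      (Module.finrank ℂ (Representation.IntertwiningMap ρ σ) : ℂ) := by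
  have := invertibleOfNonzero (NeZero.ne (Nat.card G : ℂ))
  exact Representation.card_inv_mul_sum_char_mul_char_eq_finrank ρ σ

theorem isIrrChar_iff {φ : G → ℂ} : IsIrrChar G φ ↔ IsChar G φ ∧ charInner φ φ = 1 := by
  have key (V : FDRep ℂ G) : CategoryTheory.Simple V ↔ charInner V.character V.character = 1 := by
    rw [FDRep.simple_iff_char_is_norm_one, charInner, inv_mul_eq_one₀ (NeZero.ne _)]
    exact eq_comm
  constructor
  · rintro ⟨V, hV, rfl⟩
    exact ⟨⟨V, rfl⟩, (key V).1 hV⟩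
  · rintro ⟨⟨V, rfl⟩, h⟩
    exact ⟨V, (key V).2 h, rfl⟩

theorem charInner_self {φ : G → ℂ} (h : IsIrrChar G φ) : charInner φ φ = 1 :=
  (isIrrChar_iff.1 h).2

theorem charInner_of_ne {φ θ : G → ℂ} (hφ : IsIrrChar G φ) (hθ : IsIrrChar G θ) (hne : φ ≠ θ) :
    charInner φ θ = 0 := by
  have := invertibleOfNonzero (NeZero.ne (Nat.card G : ℂ))
  obtain ⟨V, hV, rfl⟩ := hφ
  obtain ⟨W, hW, rfl⟩ := hθ
  refine (FDRep.char_orthonormal V W).trans (if_neg ?_)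
  rintro ⟨i⟩
  exact hne (FDRep.char_iso i)

theorem eq_of_charInner_ne_zero {φ θ : G → ℂ} (hφ : IsIrrChar G φ) (hθ : IsIrrChar G θ)
    (h : charInner φ θ ≠ 0) : φ = θ :=
  not_imp_comm.1 (charInner_of_ne hφ hθ) h

omit [Fintype G] in
theorem finite_setOf_isIrrChar [Finite G] : {φ : G → ℂ | IsIrrChar G φ}.Finite := by
  have := Fintype.ofFinite G
  have hli : LinearIndependent ℂ (fun φ : {φ : G → ℂ | IsIrrChar G φ} => (φ : G → ℂ)) := by
    rw [linearIndependent_iff']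
    intro s c hc φ hφ
    have h0 : charInner (∑ θ ∈ s, c θ • (θ : G → ℂ)) φ = 0 := by
      rw [hc]; simp [charInner]
    have h1 : charInner (∑ θ ∈ s, c θ • (θ : G → ℂ)) φ =
        ∑ θ ∈ s, c θ * charInner (θ : G → ℂ) φ := by
      simp only [charInner, Finset.sum_apply, Pi.smul_apply, smul_eq_mul, Finset.sum_mul,
        Finset.mul_sum]
      rw [Finset.sum_comm]
      exact Finset.sum_congr rfl fun _ _ => Finset.sum_congr rfl fun _ _ => by ring
    rw [h1, Finset.sum_eq_single_of_mem φ hφ, charInner_self φ.2, mul_one] at h0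
    · exact h0
    · intro θ _ hne
      rw [charInner_of_ne θ.2 φ.2 (fun h => hne (Subtype.ext h)), mul_zero]
  have := hli.finite
  exact Set.toFinite _

omit [Fintype G] in
theorem exists_irreducible_subrepresentation [Finite G] {V : Type} [AddCommGroup V] [Module ℂ V]
    [FiniteDimensional ℂ V] [Nontrivial V] (ρ : Representation ℂ G V) :
    ∃ S : Subrepresentation ρ, S ≠ ⊥ ∧ S.toRepresentation.IsIrreducible := by
  let P : ℕ → Prop := fun n => ∃ S : Subrepresentation ρ, S ≠ ⊥ ∧ Module.finrank ℂ S.toSubmodule = n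
  have hbt : (⊤ : Subrepresentation ρ) ≠ ⊥ := by
    intro h
    obtain ⟨v, hv⟩ := exists_ne (0 : V)
    have : v ∈ (⊤ : Subrepresentation ρ) := Submodule.mem_top
    rw [h] at this
    exact hv this
  have hP : ∃ n, P n := ⟨_, ⊤, hbt, rfl⟩
  obtain ⟨S, hS, hn⟩ := Nat.find_spec hP
  refine ⟨S, hS, ?_⟩
  have hmin (T : Subrepresentation ρ) (hT : T ≠ ⊥) (hle : T.toSubmodule ≤ S.toSubmodule) :
      T.toSubmodule = S.toSubmodule := by
    refine Submodule.eq_of_le_of_finrank_le hle ?_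
    rw [hn]
    exact Nat.find_min' hP ⟨T, hT, rfl⟩
  have hne : ∃ v ∈ S, v ≠ 0 := by
    by_contra! h
    refine hS (Subrepresentation.toSubmodule_injective ?_)
    exact (Submodule.eq_bot_iff _).2 h
  refine { exists_pair_ne := ⟨⊥, ⊤, ?_⟩, eq_bot_or_eq_top := fun T => ?_ }
  · intro h
    obtain ⟨v, hv, h0⟩ := hne
    have : (⟨v, hv⟩ : S.toSubmodule) ∈ (⊤ : Subrepresentation S.toRepresentation) :=
      Submodule.mem_top
    rw [← h] at this
    exact h0 (congrArg Subtype.val (show (⟨v, hv⟩ : S.toSubmodule) = 0 from this))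
  · let T' : Subrepresentation ρ :=
      { toSubmodule := T.toSubmodule.map S.toSubmodule.subtype
        apply_mem_toSubmodule := by
          rintro g _ ⟨v, hv, rfl⟩
          exact ⟨S.toRepresentation g v, T.apply_mem_toSubmodule g hv, rfl⟩ }
    have hinj := Submodule.map_injective_of_injective S.toSubmodule.injective_subtype
    by_cases hT : T' = ⊥
    · left
      refine Subrepresentation.toSubmodule_injective (hinj ?_)
      rw [show T.toSubmodule.map S.toSubmodule.subtype = ⊥ from
        congrArg Subrepresentation.toSubmodule hT]
      exact (Submodule.map_bot _).symm
    · right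
      refine Subrepresentation.toSubmodule_injective (hinj ?_)
      rw [show T.toSubmodule.map S.toSubmodule.subtype = S.toSubmodule from
        hmin T' hT (Submodule.map_subtype_le _ _)]
      exact (Submodule.map_subtype_top _).symm

theorem isIrrChar_of_isIrreducible {V : Type} [AddCommGroup V] [Module ℂ V]
    [FiniteDimensional ℂ V] (ρ : Representation ℂ G V) [ρ.IsIrreducible] :
    IsIrrChar G ρ.character := by
  refine isIrrChar_iff.2 ⟨isChar_of_representation ρ, ?_⟩
  simp [charInner_representation]

theorem IsChar.exists_constituent {φ : G → ℂ} (h : IsChar G φ) (h0 : φ ≠ 0) :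
    ∃ χ, IsIrrChar G χ ∧ charInner φ χ ≠ 0 := by
  obtain ⟨V, rfl⟩ := h
  have : Nontrivial V := by
    by_contra hV
    rw [not_nontrivial_iff_subsingleton] at hV
    refine h0 (funext fun g => ?_)
    change LinearMap.trace ℂ V (V.ρ g) = 0
    rw [Subsingleton.elim (V.ρ g) 0, map_zero]
  obtain ⟨S, hS, hirr⟩ := exists_irreducible_subrepresentation V.ρ
  refine ⟨_, isIrrChar_of_isIrreducible S.toRepresentation, ?_⟩
  change charInner (Representation.character V.ρ) _ ≠ 0
  rw [charInner_representation, Nat.cast_ne_zero, ← Nat.pos_iff_ne_zero,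
    Module.finrank_pos_iff_exists_ne_zero]
  refine ⟨⟨S.toSubmodule.subtype, fun g => rfl⟩, fun h => hS ?_⟩
  refine Subrepresentation.toSubmodule_injective ((Submodule.eq_bot_iff _).2 fun v hv => ?_)
  exact congrArg (fun f => f (⟨v, hv⟩ : S.toSubmodule)) h

end CharacterTheory

section FrobeniusSchur

variable {G : Type} [Group G]

theorem FS_eq_sum [Fintype G] (φ : G → ℂ) : FS G φ = (Nat.card G : ℂ)⁻¹ * ∑ g : G, φ (g ^ 2) := by
  rw [FS, finsum_eq_sum_of_fintype, div_eq_inv_mul]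

theorem IsIrrChar.inv {φ : G → ℂ} [Finite G] (h : IsIrrChar G φ) :
    IsIrrChar G (fun g => φ g⁻¹) := by
  have := Fintype.ofFinite G
  obtain ⟨⟨V, rfl⟩, h1⟩ := isIrrChar_iff.1 h
  refine isIrrChar_iff.2 ⟨⟨FDRep.of (Representation.dual V.ρ), ?_⟩, ?_⟩
  · funext g
    exact (V.char_dual g).symm
  · rw [← h1, charInner, charInner, ← Equiv.sum_comp (Equiv.inv G)]
    simp

variable {V ι : Type} [AddCommGroup V] [Module ℂ V] [FiniteDimensional ℂ V] [Fintype ι]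

/-- The average over `G` of the translates of a bilinear form. -/
noncomputable def averageForm [Fintype G] (ρ : Representation ℂ G V) :
    (V →ₗ[ℂ] V →ₗ[ℂ] ℂ) →ₗ[ℂ] (V →ₗ[ℂ] V →ₗ[ℂ] ℂ) where
  toFun B := (Nat.card G : ℂ)⁻¹ • ∑ g : G, B.compl₁₂ (ρ g) (ρ g)
  map_add' B C := by
    ext v w
    simp [Finset.sum_add_distrib, mul_add]
  map_smul' c B := by
    ext v w
    simp only [LinearMap.smul_apply, LinearMap.sum_apply, LinearMap.compl₁₂_apply, smul_eq_mul,
      RingHom.id_apply, ← Finset.mul_sum]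
    ring

omit [FiniteDimensional ℂ V] in
theorem averageForm_apply [Fintype G] (ρ : Representation ℂ G V) (B : V →ₗ[ℂ] V →ₗ[ℂ] ℂ)
    (v w : V) :
    averageForm ρ B v w = (Nat.card G : ℂ)⁻¹ * ∑ g : G, B (ρ g v) (ρ g w) := by
  simp [averageForm]

omit [FiniteDimensional ℂ V] in
theorem averageForm_invariant [Fintype G] (ρ : Representation ℂ G V) (B : V →ₗ[ℂ] V →ₗ[ℂ] ℂ)
    (h : G) (v w : V) : averageForm ρ B (ρ h v) (ρ h w) = averageForm ρ B v w := by
  rw [averageForm_apply, averageForm_apply]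
  conv_rhs => rw [← Equiv.sum_comp (Equiv.mulRight h)]
  simp

omit [FiniteDimensional ℂ V] in
theorem averageForm_of_invariant [Fintype G] (ρ : Representation ℂ G V)
    {B : V →ₗ[ℂ] V →ₗ[ℂ] ℂ} (hB : ∀ g v w, B (ρ g v) (ρ g w) = B v w) :
    averageForm ρ B = B := by
  ext v w
  simp [averageForm_apply, hB]

/-- An invariant bilinear form, as an intertwining map to the dual representation. -/
def intertwiningOfForm (ρ : Representation ℂ G V) (B : V →ₗ[ℂ] V →ₗ[ℂ] ℂ)
    (hB : ∀ g v w, B (ρ g v) (ρ g w) = B v w) :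
    Representation.IntertwiningMap ρ ρ.dual where
  toLinearMap := B
  isIntertwining' g := by
    ext v w
    have := hB g v (ρ g⁻¹ w)
    rw [ρ.self_inv_apply] at this
    exact this

omit [FiniteDimensional ℂ V] in
theorem FS_character_eq_sum [Fintype G] (ρ : Representation ℂ G V) (b : Module.Basis ι ℂ V) :
    FS G ρ.character = ∑ i, ∑ j,
      averageForm ρ ((LinearMap.mul ℂ ℂ).compl₁₂ (b.coord i) (b.coord j)) (b j) (b i) := by
  have key (g : G) : ρ.character (g ^ 2) =
      ∑ i, ∑ j, b.coord i (ρ g (b j)) * b.coord j (ρ g (b i)) := by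
    rw [Representation.character, LinearMap.trace_eq_matrix_trace ℂ b, pow_two, map_mul,
      LinearMap.toMatrix_mul, Matrix.trace]
    simp [Matrix.mul_apply, LinearMap.toMatrix_apply]
  simp only [averageForm_apply, LinearMap.compl₁₂_apply, LinearMap.mul_apply']
  simp only [FS_eq_sum, key, ← Finset.mul_sum]
  congr 1
  rw [Finset.sum_comm]
  exact Finset.sum_congr rfl fun _ _ => Finset.sum_comm

/-- A Frobenius–Schur indicator is computed by any spanning invariant form. -/
theorem FS_character_of_spanning_form [Fintype G] (ρ : Representation ℂ G V)
    {J : V →ₗ[ℂ] V →ₗ[ℂ] ℂ} (hJ : ∀ g v w, J (ρ g v) (ρ g w) = J v w) (hJ0 : J ≠ 0)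
    (hspan : ∀ B : V →ₗ[ℂ] V →ₗ[ℂ] ℂ, (∀ g v w, B (ρ g v) (ρ g w) = B v w) → ∃ c : ℂ, B = c • J) :
    FS G ρ.character = 1 ∨ FS G ρ.character = -1 := by
  let b := Module.finBasis ℂ V
  obtain ⟨ε, hε⟩ := hspan J.flip fun g v w => hJ g w v
  have hflip (v w : V) : J w v = ε * J v w := by
    simpa using LinearMap.congr_fun₂ hε v w
  have hε2 : ε * ε = 1 := by
    by_contra hne
    refine hJ0 (LinearMap.ext₂ fun v w => ?_)
    have h1 : (ε * ε - 1) * J v w = 0 := by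
      rw [sub_mul, mul_assoc, ← hflip v w, ← hflip w v]; ring
    exact (mul_eq_zero.1 h1).resolve_left (sub_ne_zero.2 hne)
  choose c hc using fun B => hspan (averageForm ρ B) (averageForm_invariant ρ B)
  obtain ⟨v, hv⟩ : ∃ v, J v ≠ 0 := by
    by_contra! h
    exact hJ0 (LinearMap.ext h)
  obtain ⟨w, hw⟩ : ∃ w, J v w ≠ 0 := by
    by_contra! h
    exact hv (LinearMap.ext h)
  have hJsum : J = ∑ i, ∑ j, J (b i) (b j) •
      (LinearMap.mul ℂ ℂ).compl₁₂ (b.coord i) (b.coord j) := by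
    refine LinearMap.ext_basis b b fun i j => ?_
    simp [LinearMap.sum_apply, Finsupp.single_apply]
  have hFS : FS G ρ.character = ε := by
    have h1 : FS G ρ.character * J v w = ε * J v w := by
      have h2 : averageForm ρ J v w = J v w := by rw [averageForm_of_invariant ρ hJ]
      rw [FS_character_eq_sum ρ b]
      conv_rhs => rw [← h2, hJsum]
      simp only [map_sum, map_smul, LinearMap.sum_apply, LinearMap.smul_apply, smul_eq_mul,
        Finset.mul_sum, Finset.sum_mul]
      refine Finset.sum_congr rfl fun i _ => Finset.sum_congr rfl fun j _ => ?_
      rw [hc]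
      simp only [LinearMap.smul_apply, smul_eq_mul]
      rw [hflip (b i) (b j)]
      ring
    exact mul_right_cancel₀ hw h1
  rw [hFS]
  exact mul_self_eq_one_iff.1 hε2

/-- The Frobenius–Schur theorem. -/
theorem IsIrrChar.FS_real_or_eq_zero [Finite G] {φ : G → ℂ} (h : IsIrrChar G φ) :
    ((∀ g, φ g⁻¹ = φ g) ∧ (FS G φ = 1 ∨ FS G φ = -1)) ∨ ((¬ ∀ g, φ g⁻¹ = φ g) ∧ FS G φ = 0) := by
  have := Fintype.ofFinite G
  have hinv := h.inv
  have hφ := h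
  obtain ⟨V, hV, rfl⟩ := h
  have hdual : (Representation.dual V.ρ).character = fun g => V.character g⁻¹ :=
    funext fun g => V.char_dual g
  have hrank := charInner_representation V.ρ (Representation.dual V.ρ)
  change charInner _ V.character = _ at hrank
  rw [hdual] at hrank
  by_cases hreal : ∀ g, V.character g⁻¹ = V.character g
  · refine Or.inl ⟨hreal, ?_⟩
    rw [funext hreal, charInner_self hφ] at hrank
    obtain ⟨J, hJ0, hJ⟩ := finrank_eq_one_iff'.1 (Nat.cast_eq_one.1 hrank.symm)
    refine FS_character_of_spanning_form V.ρ (J := J.toLinearMap) (fun g v w => ?_)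
      (fun h0 => hJ0 (Representation.IntertwiningMap.ext h0)) fun B hB => ?_
    · have := LinearMap.congr_fun (Representation.IntertwiningMap.isIntertwining _ _ J g v) (V.ρ g w)
      refine this.trans ?_
      exact congrArg (J v) (Representation.inv_self_apply V.ρ g w)
    · obtain ⟨c, hc⟩ := hJ (intertwiningOfForm V.ρ B hB)
      exact ⟨c, congrArg Representation.IntertwiningMap.toLinearMap hc.symm⟩
  · refine Or.inr ⟨hreal, ?_⟩
    rw [charInner_of_ne hinv hφ fun h => hreal (congrFun h), eq_comm, Nat.cast_eq_zero,
      Module.finrank_zero_iff] at hrank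
    refine (FS_character_eq_sum V.ρ (Module.finBasis ℂ V)).trans
      (Finset.sum_eq_zero fun i _ => Finset.sum_eq_zero fun j _ => ?_)
    have h0 (B : V →ₗ[ℂ] V →ₗ[ℂ] ℂ) : averageForm V.ρ B = 0 :=
      congrArg Representation.IntertwiningMap.toLinearMap
        (Subsingleton.elim (intertwiningOfForm V.ρ _ (averageForm_invariant V.ρ B)) 0)
    rw [h0]
    rfl

end FrobeniusSchur

section IndexTwo

variable {Ghat : Type} [Group Ghat] {G : Subgroup Ghat}

/-- The restriction of a function to a subgroup. -/
def resChar (G : Subgroup Ghat) (ψ : Ghat → ℂ) : ↥G → ℂ := fun g => ψ g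

/-- The translation `g ↦ g * x` from `G` to its nontrivial coset. -/
def cosetEquiv (h2 : G.index = 2) {x : Ghat} (hx : x ∉ G) : ↥G ≃ {h : Ghat // h ∉ G} where
  toFun g := ⟨g * x, fun h => hx ((G.mul_mem_cancel_left g.2).1 h)⟩
  invFun h := ⟨h * x⁻¹, by
    rw [Subgroup.mul_mem_iff_of_index_two h2, G.inv_mem_iff]
    simp [hx, h.2]⟩
  left_inv g := by simp
  right_inv h := by simp

theorem sum_eq_sum_add_sum_coset [Fintype Ghat] [Fintype G] (h2 : G.index = 2) {x : Ghat}
    (hx : x ∉ G) (f : Ghat → ℂ) : ∑ h, f h = ∑ g : G, f g + ∑ g : G, f (g * x) := by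
  rw [← Fintype.sum_subtype_add_sum_subtype (fun h => h ∈ G) f,
    ← Equiv.sum_comp (cosetEquiv h2 hx)]
  congr!

theorem card_eq_two_mul (h2 : G.index = 2) : (Nat.card Ghat : ℂ) = 2 * Nat.card G := by
  rw [← G.card_mul_index, h2]
  push_cast
  ring

theorem FSsharp_eq_sum [Finite Ghat] [Fintype G] (h2 : G.index = 2) {x : Ghat} (hx : x ∉ G)
    (χ : G → ℂ) : FSsharp G h2 χ = (Nat.card G : ℂ)⁻¹ *
      ∑ g : G, χ ⟨(g * x) ^ 2, Subgroup.sq_mem_of_index_two h2 _⟩ := by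
  rw [FSsharp, div_eq_inv_mul, ← finsum_set_coe_eq_finsum_mem, ← finsum_eq_sum_of_fintype]
  congr 1
  exact (finsum_comp_equiv (M := ℂ) (cosetEquiv h2 hx)
    (f := fun h => χ ⟨h.1 ^ 2, Subgroup.sq_mem_of_index_two h2 _⟩)).symm

theorem FS_eq_half [Finite Ghat] (h2 : G.index = 2) {x : Ghat} (hx : x ∉ G) (ψ : Ghat → ℂ) :
    FS Ghat ψ = (FS G (resChar G ψ) + FSsharp G h2 (resChar G ψ)) / 2 := by
  have := Fintype.ofFinite Ghat
  have := Fintype.ofFinite G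
  rw [FSsharp_eq_sum h2 hx, FS_eq_sum, FS_eq_sum, sum_eq_sum_add_sum_coset h2 hx,
    card_eq_two_mul h2, mul_inv]
  simp only [resChar, Subgroup.coe_pow]
  ring

theorem FS_add [Finite G] (χ χ' : G → ℂ) : FS G (χ + χ') = FS G χ + FS G χ' := by
  have := Fintype.ofFinite G
  simp [FS_eq_sum, Finset.sum_add_distrib, mul_add]

theorem FSsharp_add [Finite Ghat] (h2 : G.index = 2) {x : Ghat} (hx : x ∉ G) (χ χ' : G → ℂ) :
    FSsharp G h2 (χ + χ') = FSsharp G h2 χ + FSsharp G h2 χ' := by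
  have := Fintype.ofFinite G
  simp [FSsharp_eq_sum h2 hx, Finset.sum_add_distrib, mul_add]

/-- Conjugation by `x`, as an automorphism of `G`. -/
def conjAut (h2 : G.index = 2) (x : Ghat) : ↥G ≃* ↥G :=
  have := Subgroup.normal_of_index_eq_two h2
  MulAut.conjNormal x

theorem coe_conjAut (h2 : G.index = 2) (x : Ghat) (g : G) :
    (conjAut h2 x g : Ghat) = x * g * x⁻¹ := by
  have := Subgroup.normal_of_index_eq_two h2
  exact MulAut.conjNormal_apply x g

theorem bChar_apply (h2 : G.index = 2) (x : Ghat) (χ : G → ℂ) (g : G) :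
    bChar h2 x χ g = χ (conjAut h2 x g) :=
  congrArg χ (Subtype.ext (coe_conjAut h2 x g).symm)

theorem FS_bChar [Finite G] (h2 : G.index = 2) (x : Ghat) (χ : G → ℂ) :
    FS G (bChar h2 x χ) = FS G χ := by
  have := Fintype.ofFinite G
  rw [FS_eq_sum, FS_eq_sum, ← Equiv.sum_comp (conjAut h2 x).toEquiv (fun g => χ (g ^ 2))]
  simp [bChar_apply]

theorem FSsharp_bChar [Finite Ghat] (h2 : G.index = 2) {x : Ghat} (hx : x ∉ G) (χ : G → ℂ) :
    FSsharp G h2 (bChar h2 x χ) = FSsharp G h2 χ := by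
  have := Fintype.ofFinite G
  rw [FSsharp_eq_sum h2 hx, FSsharp_eq_sum h2 hx]
  congr 1
  rw [← Equiv.sum_comp (conjAut h2 x).toEquiv
    (fun g : G => χ ⟨(g * x) ^ 2, Subgroup.sq_mem_of_index_two h2 _⟩)]
  refine Fintype.sum_congr _ _ fun g => congrArg χ (Subtype.ext ?_)
  simp only [MulEquiv.toEquiv_eq_coe, EquivLike.coe_coe, coe_conjAut, pow_two]
  group

theorem charInner_bChar [Fintype G] (h2 : G.index = 2) (x : Ghat) (χ θ : G → ℂ) :
    charInner (bChar h2 x χ) (bChar h2 x θ) = charInner χ θ := by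
  rw [charInner, charInner, ← Equiv.sum_comp (conjAut h2 x).toEquiv (fun g => χ g * θ g⁻¹)]
  simp [bChar_apply]

theorem IsChar.bChar {χ : G → ℂ} (h : IsChar G χ) (h2 : G.index = 2) (x : Ghat) :
    IsChar G (bChar h2 x χ) := by
  obtain ⟨V, rfl⟩ := h
  refine ⟨FDRep.of (V.ρ.comp (conjAut h2 x).toMonoidHom), funext fun g => ?_⟩
  exact bChar_apply h2 x _ g

theorem IsIrrChar.bChar [Finite G] {χ : G → ℂ} (h : IsIrrChar G χ) (h2 : G.index = 2) (x : Ghat) :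
    IsIrrChar G (bChar h2 x χ) := by
  have := Fintype.ofFinite G
  rw [isIrrChar_iff] at h ⊢
  exact ⟨h.1.bChar h2 x, (charInner_bChar h2 x χ χ).trans h.2⟩

theorem bChar_bChar {χ : G → ℂ} (h : IsChar G χ) (h2 : G.index = 2) (x : Ghat) :
    bChar h2 x (bChar h2 x χ) = χ := by
  funext g
  have := h.conj (⟨x ^ 2, Subgroup.sq_mem_of_index_two h2 x⟩ : G) g
  rw [← this, bChar_apply, bChar_apply]
  refine congrArg χ (Subtype.ext ?_)
  simp [coe_conjAut, pow_two, mul_assoc]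

theorem IsChar.resChar {ψ : Ghat → ℂ} (h : IsChar Ghat ψ) : IsChar G (resChar G ψ) := by
  obtain ⟨V, rfl⟩ := h
  exact ⟨FDRep.of (V.ρ.comp G.subtype), rfl⟩

theorem bChar_resChar {ψ : Ghat → ℂ} (h : IsChar Ghat ψ) (h2 : G.index = 2) (x : Ghat) :
    bChar h2 x (resChar G ψ) = resChar G ψ :=
  funext fun g => h.conj x g

/-- The sign character of `Ghat` with kernel `G`. -/
noncomputable def cosetSign (h2 : G.index = 2) : Ghat →* ℂ where
  toFun h := if h ∈ G then 1 else -1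
  map_one' := if_pos G.one_mem
  map_mul' a b := by
    by_cases ha : a ∈ G <;> by_cases hb : b ∈ G <;>
      simp [Subgroup.mul_mem_iff_of_index_two h2, ha, hb]

theorem cosetSign_coe (h2 : G.index = 2) (g : G) : cosetSign h2 (g : Ghat) = 1 := if_pos g.2

theorem cosetSign_of_notMem (h2 : G.index = 2) {h : Ghat} (hh : h ∉ G) : cosetSign h2 h = -1 :=
  if_neg hh

/-- The product of `ψ` with the sign character. -/
noncomputable def twistChar (h2 : G.index = 2) (ψ : Ghat → ℂ) : Ghat → ℂ :=
  fun h => cosetSign h2 h * ψ h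

theorem resChar_twistChar (h2 : G.index = 2) (ψ : Ghat → ℂ) :
    resChar G (twistChar h2 ψ) = resChar G ψ := by
  funext g
  simp [resChar, twistChar, cosetSign_coe]

theorem IsChar.twistChar {ψ : Ghat → ℂ} (h : IsChar Ghat ψ) (h2 : G.index = 2) :
    IsChar Ghat (twistChar h2 ψ) := by
  obtain ⟨V, rfl⟩ := h
  let ρ : Representation ℂ Ghat V :=
    { toFun := fun h => cosetSign h2 h • V.ρ h
      map_one' := by simp
      map_mul' := fun a b => by simp [smul_smul, _root_.mul_comm (cosetSign h2 b)] }
  refine ⟨FDRep.of ρ, funext fun h => ?_⟩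
  exact (map_smul (LinearMap.trace ℂ V) (cosetSign h2 h) (V.ρ h)).symm

theorem IsIrrChar.twistChar [Finite Ghat] {ψ : Ghat → ℂ} (h : IsIrrChar Ghat ψ)
    (h2 : G.index = 2) : IsIrrChar Ghat (twistChar h2 ψ) := by
  have := Fintype.ofFinite Ghat
  rw [isIrrChar_iff] at h ⊢
  refine ⟨h.1.twistChar h2, Eq.trans ?_ h.2⟩
  unfold charInner
  congr 1
  refine Fintype.sum_congr _ _ fun g => ?_
  have : cosetSign h2 g * cosetSign h2 g⁻¹ = 1 := by rw [← map_mul, mul_inv_cancel, map_one]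
  unfold _root_.twistChar
  linear_combination (ψ g * ψ g⁻¹) * this

theorem charInner_add_charInner_twistChar [Fintype Ghat] [Fintype G] (h2 : G.index = 2) {x : Ghat}
    (hx : x ∉ G) (ψ θ : Ghat → ℂ) :
    charInner ψ θ + charInner ψ (twistChar h2 θ) = charInner (resChar G ψ) (resChar G θ) := by
  have h1 (g : G) : twistChar h2 θ (g : Ghat)⁻¹ = θ (g : Ghat)⁻¹ := by
    rw [twistChar, ← G.coe_inv, cosetSign_coe, one_mul]
  have h3 (g : G) : twistChar h2 θ ((g : Ghat) * x)⁻¹ = - θ ((g : Ghat) * x)⁻¹ := by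
    rw [twistChar, cosetSign_of_notMem, neg_one_mul]
    rw [G.inv_mem_iff]
    exact (cosetEquiv h2 hx g).2
  simp only [charInner, sum_eq_sum_add_sum_coset h2 hx, h1, h3, card_eq_two_mul h2, resChar,
    G.coe_inv, mul_neg, Finset.sum_neg_distrib, mul_inv]
  ring

/-- The function on `Ghat` induced from `χ`. -/
noncomputable def indChar (h2 : G.index = 2) (x : Ghat) (χ : G → ℂ) : Ghat → ℂ :=
  fun h => if hh : h ∈ G then χ ⟨h, hh⟩ + bChar h2 x χ ⟨h, hh⟩ else 0

theorem resChar_indChar (h2 : G.index = 2) (x : Ghat) (χ : G → ℂ) :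
    resChar G (indChar h2 x χ) = χ + bChar h2 x χ :=
  funext fun g => dif_pos g.2

theorem twistChar_indChar (h2 : G.index = 2) (x : Ghat) (χ : G → ℂ) :
    twistChar h2 (indChar h2 x χ) = indChar h2 x χ := by
  funext h
  by_cases hh : h ∈ G
  · rw [twistChar, cosetSign_coe h2 ⟨h, hh⟩, one_mul]
  · simp [twistChar, indChar, hh]

theorem charInner_indChar [Fintype Ghat] [Fintype G] (h2 : G.index = 2) {x : Ghat}
    (hx : x ∉ G) (ψ : Ghat → ℂ) (χ : G → ℂ) :
    charInner ψ (indChar h2 x χ) = charInner (resChar G ψ) (χ + bChar h2 x χ) / 2 := by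
  have := charInner_add_charInner_twistChar h2 hx ψ (indChar h2 x χ)
  rw [twistChar_indChar, resChar_indChar] at this
  linear_combination this / 2

theorem FS_indChar [Finite Ghat] (h2 : G.index = 2) {x : Ghat} (hx : x ∉ G) (χ : G → ℂ) :
    FS Ghat (indChar h2 x χ) = FS G χ + FSsharp G h2 χ := by
  rw [FS_eq_half h2 hx, resChar_indChar, FS_add, FSsharp_add h2 hx, FS_bChar, FSsharp_bChar h2 hx]
  ring

theorem indChar_bChar {χ : G → ℂ} (h : IsChar G χ) (h2 : G.index = 2) (x : Ghat) :
    indChar h2 x (bChar h2 x χ) = indChar h2 x χ := by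
  funext g
  simp only [indChar, bChar_bChar h, add_comm]

section Extension

variable {V : Type} [AddCommGroup V] [Module ℂ V] (ρ : Representation ℂ G V)

/-- A representation of a subgroup, extended by zero. -/
noncomputable def zeroExtend (h : Ghat) : V →ₗ[ℂ] V := if hh : h ∈ G then ρ ⟨h, hh⟩ else 0

theorem zeroExtend_coe (g : G) : zeroExtend ρ (g : Ghat) = ρ g := dif_pos g.2

theorem zeroExtend_of_notMem {h : Ghat} (hh : h ∉ G) : zeroExtend ρ h = 0 := dif_neg hh

theorem zeroExtend_one : zeroExtend ρ (1 : Ghat) = 1 := by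
  rw [← G.coe_one, zeroExtend_coe, map_one]

theorem zeroExtend_mul_of_right {a b : Ghat} (hb : b ∈ G) :
    zeroExtend ρ (a * b) = zeroExtend ρ a * zeroExtend ρ b := by
  by_cases ha : a ∈ G
  · simp only [zeroExtend, dif_pos ha, dif_pos hb, dif_pos (G.mul_mem ha hb), ← map_mul]
    rfl
  · rw [zeroExtend_of_notMem ρ ha, zero_mul, zeroExtend_of_notMem]
    rwa [G.mul_mem_cancel_right hb]

theorem zeroExtend_mul (h2 : G.index = 2) {x : Ghat} (hx : x ∉ G) (a b : Ghat) :
    zeroExtend ρ (a * b) =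
      zeroExtend ρ a * zeroExtend ρ b + zeroExtend ρ (a * x⁻¹) * zeroExtend ρ (x * b) := by
  by_cases hb : b ∈ G
  · have : x * b ∉ G := by rwa [G.mul_mem_cancel_right hb]
    rw [zeroExtend_mul_of_right ρ hb, zeroExtend_of_notMem ρ this, mul_zero, add_zero]
  · have : x * b ∈ G := by simp [Subgroup.mul_mem_iff_of_index_two h2, hx, hb]
    rw [← zeroExtend_mul_of_right ρ this, zeroExtend_of_notMem ρ hb, mul_zero, zero_add]
    congr 1
    group

/-- The endomorphism of `V × V` by which `h` acts in the induced representation. -/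
noncomputable def inducedEnd (x h : Ghat) : V × V →ₗ[ℂ] V × V :=
  LinearMap.inl ℂ V V ∘ₗ (zeroExtend ρ h ∘ₗ LinearMap.fst ℂ V V) +
    LinearMap.inl ℂ V V ∘ₗ (zeroExtend ρ (h * x⁻¹) ∘ₗ LinearMap.snd ℂ V V) +
    LinearMap.inr ℂ V V ∘ₗ (zeroExtend ρ (x * h) ∘ₗ LinearMap.fst ℂ V V) +
    LinearMap.inr ℂ V V ∘ₗ (zeroExtend ρ (x * h * x⁻¹) ∘ₗ LinearMap.snd ℂ V V)

theorem inducedEnd_apply (x h : Ghat) (v : V × V) :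
    inducedEnd ρ x h v = (zeroExtend ρ h v.1 + zeroExtend ρ (h * x⁻¹) v.2,
      zeroExtend ρ (x * h) v.1 + zeroExtend ρ (x * h * x⁻¹) v.2) := by
  simp [inducedEnd]

/-- The induced representation from a subgroup of index two. -/
noncomputable def inducedRep (h2 : G.index = 2) {x : Ghat} (hx : x ∉ G) :
    Representation ℂ Ghat (V × V) where
  toFun := inducedEnd ρ x
  map_one' := by
    refine LinearMap.ext fun v => ?_
    have hx' : x⁻¹ ∉ G := by rwa [G.inv_mem_iff]
    simp [inducedEnd_apply, zeroExtend_one, zeroExtend_of_notMem ρ hx, zeroExtend_of_notMem ρ hx']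
  map_mul' a b := by
    refine LinearMap.ext fun v => ?_
    have h1 := zeroExtend_mul ρ h2 hx a b
    have h3 := zeroExtend_mul ρ h2 hx a (b * x⁻¹)
    have h4 := zeroExtend_mul ρ h2 hx (x * a) b
    have h5 := zeroExtend_mul ρ h2 hx (x * a) (b * x⁻¹)
    simp only [← mul_assoc] at h3 h4 h5
    simp only [Module.End.mul_apply, inducedEnd_apply, ← mul_assoc, h1, h3, h4, h5,
      LinearMap.add_apply, map_add, Prod.mk.injEq]
    constructor <;> abel

theorem trace_inducedEnd [FiniteDimensional ℂ V] (x h : Ghat) :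
    LinearMap.trace ℂ (V × V) (inducedEnd ρ x h) =
      LinearMap.trace ℂ V (zeroExtend ρ h) + LinearMap.trace ℂ V (zeroExtend ρ (x * h * x⁻¹)) := by
  simp only [inducedEnd, map_add]
  rw [LinearMap.trace_comp_comm' _ (LinearMap.inl ℂ V V),
    LinearMap.trace_comp_comm' _ (LinearMap.inl ℂ V V),
    LinearMap.trace_comp_comm' _ (LinearMap.inr ℂ V V),
    LinearMap.trace_comp_comm' _ (LinearMap.inr ℂ V V)]
  simp [LinearMap.comp_assoc]

end Extension

theorem IsChar.indChar {χ : G → ℂ} (h : IsChar G χ) (h2 : G.index = 2) {x : Ghat} (hx : x ∉ G) :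
    IsChar Ghat (indChar h2 x χ) := by
  obtain ⟨V, rfl⟩ := h
  refine ⟨FDRep.of (inducedRep V.ρ h2 hx), funext fun h => ?_⟩
  refine Eq.trans ?_ (trace_inducedEnd V.ρ x h).symm
  have hn := Subgroup.normal_of_index_eq_two h2
  by_cases hh : h ∈ G
  · have h1 := hn.conj_mem h hh x
    simp only [_root_.indChar, zeroExtend, dif_pos hh, dif_pos h1]
    rfl
  · have h1 : x * h * x⁻¹ ∉ G := by
      rwa [hn.mem_comm_iff, inv_mul_cancel_left]
    simp [_root_.indChar, zeroExtend, hh, h1]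

theorem IsIrrChar.indChar [Finite Ghat] {χ : G → ℂ} (h : IsIrrChar G χ) (h2 : G.index = 2)
    {x : Ghat} (hx : x ∉ G) (hb : _root_.bChar h2 x χ ≠ χ) :
    IsIrrChar Ghat (indChar h2 x χ) := by
  have := Fintype.ofFinite Ghat
  have := Fintype.ofFinite G
  refine isIrrChar_iff.2 ⟨h.isChar.indChar h2 hx, ?_⟩
  have hχb := h.bChar h2 x
  rw [charInner_indChar h2 hx, resChar_indChar, charInner_add_right, charInner_add_left,
    charInner_add_left, charInner_self h, charInner_self hχb, charInner_of_ne h hχb hb.symm,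
    charInner_of_ne hχb h hb]
  norm_num

end IndexTwo

section Extension

variable {Ghat : Type} [Group Ghat] {G : Subgroup Ghat}

/-- The extension of a representation of `G` to `Ghat` in which `x` acts by `T`. -/
noncomputable def extendRep (h2 : G.index = 2) {x : Ghat} (hx : x ∉ G) {V : Type}
    [AddCommGroup V] [Module ℂ V] (ρ : Representation ℂ G V) (T : V →ₗ[ℂ] V)
    (hT : ∀ g : Ghat, T * zeroExtend ρ g = zeroExtend ρ (x * g * x⁻¹) * T)
    (hT2 : T * T = zeroExtend ρ (x * x)) : Representation ℂ Ghat V where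
  toFun h := zeroExtend ρ h + zeroExtend ρ (h * x⁻¹) * T
  map_one' := by
    have hx' : x⁻¹ ∉ G := by rwa [G.inv_mem_iff]
    simp [zeroExtend_one, zeroExtend_of_notMem ρ hx']
  map_mul' a b := by
    have hxx : x * x ∈ G := by rw [← pow_two]; exact Subgroup.sq_mem_of_index_two h2 x
    have h1 := zeroExtend_mul ρ h2 hx a (b * x⁻¹)
    have h3 : zeroExtend ρ (x * b) = zeroExtend ρ (x * (b * x⁻¹) * x⁻¹) * (T * T) := by
      rw [hT2, ← zeroExtend_mul_of_right ρ hxx]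
      congr 1
      group
    have h4 (S : V →ₗ[ℂ] V) : T * (zeroExtend ρ (b * x⁻¹) * S) =
        zeroExtend ρ (x * (b * x⁻¹) * x⁻¹) * (T * S) := by
      rw [← mul_assoc, hT, mul_assoc]
    have h5 := hT b
    simp only [mul_assoc] at h1 h3 h4 h5
    simp only [zeroExtend_mul ρ h2 hx a b, mul_assoc, h1, h3, h4, h5, add_mul, mul_add]
    abel

theorem extendRep_coe (h2 : G.index = 2) {x : Ghat} (hx : x ∉ G) {V : Type}
    [AddCommGroup V] [Module ℂ V] (ρ : Representation ℂ G V) (T : V →ₗ[ℂ] V)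
    (hT : ∀ g : Ghat, T * zeroExtend ρ g = zeroExtend ρ (x * g * x⁻¹) * T)
    (hT2 : T * T = zeroExtend ρ (x * x)) (g : G) : extendRep h2 hx ρ T hT hT2 g = ρ g := by
  have : (g : Ghat) * x⁻¹ ∉ G := by rwa [G.mul_mem_cancel_left g.2, G.inv_mem_iff]
  change zeroExtend ρ (g : Ghat) + zeroExtend ρ (g * x⁻¹) * T = ρ g
  rw [zeroExtend_coe, zeroExtend_of_notMem ρ this, zero_mul, add_zero]

end Extension

theorem IsChar.exists_natCast_eq_charInner {G : Type} [Group G] [Fintype G] {φ θ : G → ℂ}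
    (hφ : IsChar G φ) (hθ : IsChar G θ) : ∃ n : ℕ, charInner φ θ = n := by
  obtain ⟨V, rfl⟩ := hφ
  obtain ⟨W, rfl⟩ := hθ
  exact ⟨_, charInner_representation W.ρ V.ρ⟩

theorem IsIrrChar.ne_zero {G : Type} [Group G] [Finite G] {φ : G → ℂ} (h : IsIrrChar G φ) :
    φ ≠ 0 := by
  have := Fintype.ofFinite G
  rintro rfl
  simpa [charInner] using charInner_self h

theorem IsChar.charInner_self_ne_zero {G : Type} [Group G] [Fintype G] {φ : G → ℂ}
    (h : IsChar G φ) (h0 : φ ≠ 0) : charInner φ φ ≠ 0 := by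
  obtain ⟨V, rfl⟩ := h
  intro hV
  have h1 := (charInner_representation V.ρ V.ρ).symm.trans hV
  rw [Nat.cast_eq_zero, Module.finrank_zero_iff] at h1
  have h2 : Representation.IntertwiningMap.id V.ρ = 0 := Subsingleton.elim _ _
  refine h0 (funext fun g => ?_)
  have h3 : V.ρ g = 0 := LinearMap.ext fun v => DFunLike.congr_fun h2 (V.ρ g v)
  exact (congrArg (LinearMap.trace ℂ V) h3).trans (map_zero _)

section Clifford

variable {Ghat : Type} [Group Ghat] {G : Subgroup Ghat}

theorem isIrrChar_of_resChar [Finite Ghat] (h2 : G.index = 2) {x : Ghat} (hx : x ∉ G)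
    {ψ : Ghat → ℂ} (h : IsChar Ghat ψ) (hr : IsIrrChar G (resChar G ψ)) : IsIrrChar Ghat ψ := by
  have := Fintype.ofFinite Ghat
  have := Fintype.ofFinite G
  obtain ⟨n, hn⟩ := h.exists_natCast_eq_charInner h
  obtain ⟨m, hm⟩ := h.exists_natCast_eq_charInner (h.twistChar h2)
  have hψ : ψ ≠ 0 := by
    rintro rfl
    exact hr.ne_zero rfl
  have hn0 := h.charInner_self_ne_zero hψ
  have hsum := charInner_add_charInner_twistChar h2 hx ψ ψ
  rw [charInner_self hr, hn, hm] at hsum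
  rw [hn] at hn0
  refine isIrrChar_iff.2 ⟨h, ?_⟩
  norm_cast at hsum hn0
  rw [hn, show n = 1 by omega, Nat.cast_one]

theorem exists_conj_intertwiner [Finite Ghat] (h2 : G.index = 2) (x : Ghat) (V : FDRep ℂ G)
    (hV : IsIrrChar G V.character) (hb : bChar h2 x V.character = V.character) :
    ∃ J : V ≃ₗ[ℂ] V, ∀ g v, J (V.ρ g v) = V.ρ (conjAut h2 x g) (J v) := by
  have := Fintype.ofFinite G
  have := invertibleOfNonzero (NeZero.ne (Nat.card G : ℂ))
  let W : FDRep ℂ G := FDRep.of (V.ρ.comp (conjAut h2 x).toMonoidHom)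
  have hW : W.character = V.character :=
    Eq.trans (funext fun g => (bChar_apply h2 x V.character g).symm) hb
  have hVs : CategoryTheory.Simple V := by
    rw [FDRep.simple_iff_char_is_norm_one]
    have := charInner_self hV
    rw [charInner, inv_mul_eq_one₀ (NeZero.ne _)] at this
    exact this.symm
  have hWs : CategoryTheory.Simple W := by
    rw [FDRep.simple_iff_char_is_norm_one] at hVs ⊢
    rwa [hW]
  have hiso : Nonempty (V ≅ W) := by
    by_contra hne
    have h0 := (FDRep.char_orthonormal V W).trans (if_neg hne)
    rw [hW] at h0
    exact one_ne_zero ((charInner_self hV).symm.trans h0)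
  obtain ⟨i⟩ := hiso
  let e := FDRep.isoToLinearEquiv i
  refine ⟨e, fun g v => ?_⟩
  change e (V.ρ g v) = W.ρ g (e v)
  rw [FDRep.Iso.conj_ρ i g]
  simp [LinearEquiv.conj_apply, e]

theorem IsIrrChar.exists_extension [Finite Ghat] {χ : G → ℂ} (h : IsIrrChar G χ)
    (h2 : G.index = 2) {x : Ghat} (hx : x ∉ G) (hb : _root_.bChar h2 x χ = χ) :
    ∃ ψ, IsIrrChar Ghat ψ ∧ resChar G ψ = χ := by
  have := Fintype.ofFinite G
  obtain ⟨V, rfl⟩ := h.isChar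
  obtain ⟨J, hJ⟩ := exists_conj_intertwiner h2 x V h hb
  let z : G := ⟨x * x, by rw [← pow_two]; exact Subgroup.sq_mem_of_index_two h2 x⟩
  have hz (g : G) : conjAut h2 x (conjAut h2 x g) = z * g * z⁻¹ := by
    refine Subtype.ext ?_
    simp [coe_conjAut, z, mul_assoc]
  have hfin : Module.finrank ℂ (Representation.IntertwiningMap V.ρ V.ρ) = 1 := by
    have := (charInner_representation V.ρ V.ρ).symm.trans (charInner_self h)
    exact_mod_cast this
  have hid : Representation.IntertwiningMap.id V.ρ ≠ 0 := by
    intro h0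
    refine h.ne_zero (funext fun g => ?_)
    have h3 : V.ρ g = 0 := LinearMap.ext fun v => DFunLike.congr_fun h0 (V.ρ g v)
    exact (congrArg (LinearMap.trace ℂ V) h3).trans (map_zero _)
  let K : Representation.IntertwiningMap V.ρ V.ρ :=
    ⟨V.ρ z⁻¹ ∘ₗ J.toLinearMap ∘ₗ J.toLinearMap, fun g => by
      refine LinearMap.ext fun v => ?_
      change V.ρ z⁻¹ (J (J (V.ρ g v))) = V.ρ g (V.ρ z⁻¹ (J (J v)))
      rw [hJ, hJ, hz, ← Module.End.mul_apply, ← Module.End.mul_apply, ← map_mul, ← map_mul,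
        mul_assoc, inv_mul_cancel_left]⟩
  obtain ⟨c, hc⟩ := (finrank_eq_one_iff_of_nonzero' _ hid).1 hfin K
  have hJJ (v : V) : J (J v) = c • V.ρ z v := by
    have h1 : V.ρ z⁻¹ (J (J v)) = c • v := (DFunLike.congr_fun hc v).symm
    rw [← map_smul, ← h1, ← Module.End.mul_apply, ← map_mul, mul_inv_cancel, map_one,
      Module.End.one_apply]
  have hc0 : c ≠ 0 := by
    rintro rfl
    refine hid (DFunLike.ext _ _ fun v => ?_)
    have := hJJ v
    rw [zero_smul] at this
    simpa using this
  obtain ⟨s, hs⟩ := IsAlgClosed.exists_pow_nat_eq c two_pos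
  have hs0 : s ≠ 0 := by
    rintro rfl
    exact hc0 (by simpa using hs.symm)
  have hn := Subgroup.normal_of_index_eq_two h2
  have hT (g : Ghat) : (s⁻¹ • J.toLinearMap) * zeroExtend V.ρ g =
      zeroExtend V.ρ (x * g * x⁻¹) * (s⁻¹ • J.toLinearMap) := by
    by_cases hg : g ∈ G
    · refine LinearMap.ext fun v => ?_
      have h1 := zeroExtend_coe V.ρ (⟨g, hg⟩ : G)
      have h3 := zeroExtend_coe V.ρ (conjAut h2 x ⟨g, hg⟩)
      rw [coe_conjAut] at h3
      simp only at h1 h3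
      simp [h1, h3, hJ]
    · have h1 : x * g * x⁻¹ ∉ G := by rwa [hn.mem_comm_iff, inv_mul_cancel_left]
      rw [zeroExtend_of_notMem V.ρ hg, zeroExtend_of_notMem V.ρ h1, mul_zero, zero_mul]
  have hT2 : (s⁻¹ • J.toLinearMap) * (s⁻¹ • J.toLinearMap) = zeroExtend V.ρ (x * x) := by
    refine LinearMap.ext fun v => ?_
    have h1 : zeroExtend V.ρ (x * x) = V.ρ z := zeroExtend_coe V.ρ z
    rw [h1]
    simp only [Module.End.mul_apply, LinearMap.smul_apply, LinearEquiv.coe_coe, map_smul, hJJ,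
      smul_smul, ← hs]
    field_simp
    simp
  let σ := extendRep h2 hx V.ρ (s⁻¹ • J.toLinearMap) hT hT2
  have hres : resChar G σ.character = V.character :=
    funext fun g => congrArg (LinearMap.trace ℂ V) (extendRep_coe h2 hx V.ρ _ hT hT2 g)
  exact ⟨σ.character, isIrrChar_of_resChar h2 hx (isChar_of_representation σ) (hres ▸ h), hres⟩

theorem IsIrrChar.eq_or_eq_twistChar [Finite Ghat] {ψ ψ' : Ghat → ℂ} (h : IsIrrChar Ghat ψ)
    (h' : IsIrrChar Ghat ψ') (h2 : G.index = 2) {x : Ghat} (hx : x ∉ G) [Fintype G]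
    (hne : charInner (resChar G ψ) (resChar G ψ') ≠ 0) :
    ψ = ψ' ∨ ψ = _root_.twistChar h2 ψ' := by
  have := Fintype.ofFinite Ghat
  rw [← charInner_add_charInner_twistChar h2 hx] at hne
  by_cases h0 : charInner ψ ψ' = 0
  · rw [h0, zero_add] at hne
    exact Or.inr (eq_of_charInner_ne_zero h (h'.twistChar h2) hne)
  · exact Or.inl (eq_of_charInner_ne_zero h h' h0)

theorem IsIrrChar.ne_twistChar [Finite Ghat] {ψ : Ghat → ℂ} (h : IsIrrChar Ghat ψ)
    (h2 : G.index = 2) {x : Ghat} (hx : x ∉ G) (hr : IsIrrChar G (resChar G ψ)) :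
    ψ ≠ _root_.twistChar h2 ψ := by
  have := Fintype.ofFinite Ghat
  have := Fintype.ofFinite G
  intro he
  have hsum := charInner_add_charInner_twistChar h2 hx ψ ψ
  rw [← he, charInner_self h, charInner_self hr] at hsum
  norm_num at hsum

theorem charInner_resChar_bChar [Fintype G] (h2 : G.index = 2) (x : Ghat) {ψ : Ghat → ℂ}
    (h : IsChar Ghat ψ) (χ : G → ℂ) :
    charInner (resChar G ψ) (bChar h2 x χ) = charInner (resChar G ψ) χ := by
  conv_lhs => rw [← bChar_resChar h h2 x]
  exact charInner_bChar h2 x _ _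

/-- Clifford theory for a subgroup of index two: every irreducible character either restricts to
an irreducible character or is induced. -/
theorem IsIrrChar.isIrrChar_resChar_or_eq_indChar [Finite Ghat] {ψ : Ghat → ℂ}
    (h : IsIrrChar Ghat ψ) (h2 : G.index = 2) {x : Ghat} (hx : x ∉ G) :
    IsIrrChar G (resChar G ψ) ∨
      ∃ χ, IsIrrChar G χ ∧ _root_.bChar h2 x χ ≠ χ ∧ _root_.indChar h2 x χ = ψ := by
  have := Fintype.ofFinite Ghat
  have := Fintype.ofFinite G
  have h0 : resChar G ψ ≠ 0 := by
    intro h0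
    have hsum := charInner_add_charInner_twistChar h2 hx ψ ψ
    obtain ⟨m, hm⟩ := h.isChar.exists_natCast_eq_charInner (h.twistChar h2).isChar
    rw [charInner_self h, hm, h0] at hsum
    simp only [charInner, Pi.zero_apply, Finset.sum_const_zero, mul_zero] at hsum
    norm_cast at hsum
    omega
  obtain ⟨χ, hχ, hne⟩ := h.isChar.resChar.exists_constituent h0
  by_cases hb : _root_.bChar h2 x χ = χ
  · left
    obtain ⟨θ, hθ, rfl⟩ := hχ.exists_extension h2 hx hb
    obtain rfl | rfl := h.eq_or_eq_twistChar hθ h2 hx hne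
    · exact hχ
    · rwa [resChar_twistChar]
  · refine Or.inr ⟨χ, hχ, hb, (eq_of_charInner_ne_zero h (hχ.indChar h2 hx hb) ?_).symm⟩
    rw [charInner_indChar h2 hx, charInner_add_right, charInner_resChar_bChar h2 x h.isChar]
    simpa using hne

theorem IsIrrChar.not_isIrrChar_resChar_indChar [Finite Ghat] {χ : G → ℂ} (h : IsIrrChar G χ)
    (h2 : G.index = 2) {x : Ghat} (hb : _root_.bChar h2 x χ ≠ χ) :
    ¬ IsIrrChar G (resChar G (_root_.indChar h2 x χ)) := by
  have := Fintype.ofFinite G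
  intro hr
  have hχb := h.bChar h2 x
  have := charInner_self hr
  rw [resChar_indChar, charInner_add_right, charInner_add_left, charInner_add_left,
    charInner_self h, charInner_self hχb, charInner_of_ne h hχb hb.symm,
    charInner_of_ne hχb h hb] at this
  norm_num at this

theorem eq_or_eq_bChar_of_indChar_eq [Finite Ghat] {χ χ' : G → ℂ} (h : IsIrrChar G χ)
    (h' : IsIrrChar G χ') (h2 : G.index = 2) {x : Ghat}
    (he : indChar h2 x χ = indChar h2 x χ') : χ = χ' ∨ χ = bChar h2 x χ' := by
  have := Fintype.ofFinite G
  by_contra! hne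
  have he' := congrArg (resChar G) he
  rw [resChar_indChar, resChar_indChar] at he'
  have h1 := congrArg (charInner χ) he'
  rw [charInner_add_right, charInner_add_right, charInner_of_ne h h' hne.1,
    charInner_of_ne h (h'.bChar h2 x) hne.2, charInner_self h] at h1
  obtain ⟨m, hm⟩ := h.isChar.exists_natCast_eq_charInner (h.bChar h2 x).isChar
  rw [hm, add_zero] at h1
  norm_cast at h1
  omega

/-- An irreducible character of `G` with vanishing total indicator that is not fixed by `b` has
vanishing Frobenius–Schur indicator. -/
theorem IsIrrChar.FS_eq_zero_of_bChar_ne [Finite Ghat] {χ : G → ℂ} (h : IsIrrChar G χ)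
    (h2 : G.index = 2) {x : Ghat} (hx : x ∉ G) (hb : _root_.bChar h2 x χ ≠ χ)
    (hf : FS G χ + FSsharp G h2 χ = 0) : FS G χ = 0 := by
  obtain ⟨hreal, -⟩ | ⟨-, h0⟩ := h.FS_real_or_eq_zero
  · exfalso
    obtain ⟨-, hr⟩ | ⟨hr, -⟩ := (h.indChar h2 hx hb).FS_real_or_eq_zero
    · rw [FS_indChar h2 hx, hf] at hr
      simp at hr
    · refine hr fun g => ?_
      by_cases hg : g ∈ G
      · have hg' : g⁻¹ ∈ G := G.inv_mem hg
        simp only [_root_.indChar, dif_pos hg, dif_pos hg', bChar_apply]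
        rw [← hreal ⟨g, hg⟩, ← hreal (conjAut h2 x ⟨g, hg⟩), ← map_inv]
        rfl
      · simp [_root_.indChar, hg]
  · exact h0

end Clifford

theorem ncard_eq_two_mul {α β : Type*} {s : Set α} {t : Set β} (hs : s.Finite) (ht : t.Finite)
    (f : α → β) (hf : Set.MapsTo f s t) (hfib : ∀ b ∈ t, {a ∈ s | f a = b}.ncard = 2) :
    s.ncard = 2 * t.ncard := by
  rw [Set.ncard_eq_toFinset_card s hs, Set.ncard_eq_toFinset_card t ht,
    Finset.card_eq_sum_card_fiberwise (f := f) (t := ht.toFinset) (by simpa using hf),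
    Finset.sum_const_nat (m := 2), mul_comm]
  intro b hb
  rw [← hfib b (by simpa using hb), ← Set.ncard_coe_finset]
  congr 1
  ext a
  simp

section Count

variable {Ghat : Type} [Group Ghat] [Finite Ghat] (G : Subgroup Ghat) (h2 : G.index = 2)
  {x : Ghat} (hx : x ∉ G)

include hx

theorem ncard_setOf_isIrrChar_resChar :
    {ψ | IsIrrChar Ghat ψ ∧ FS Ghat ψ = 0 ∧ IsIrrChar G (resChar G ψ)}.ncard =
      2 * {χ | IsIrrChar G χ ∧ FS G χ + FSsharp G h2 χ = 0 ∧ bChar h2 x χ = χ}.ncard := by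
  have := Fintype.ofFinite G
  refine ncard_eq_two_mul (finite_setOf_isIrrChar.subset fun _ h => h.1)
    (finite_setOf_isIrrChar.subset fun _ h => h.1) (resChar G) ?_ ?_
  · rintro ψ ⟨h, h0, hr⟩
    refine ⟨hr, ?_, bChar_resChar h.isChar h2 x⟩
    rw [FS_eq_half h2 hx] at h0
    linear_combination 2 * h0
  · rintro χ ⟨hχ, h0, hb⟩
    obtain ⟨ψ, hψ, rfl⟩ := hχ.exists_extension h2 hx hb
    rw [Set.ncard_eq_two]
    refine ⟨ψ, twistChar h2 ψ, hψ.ne_twistChar h2 hx hχ, Set.ext fun θ => ⟨?_, ?_⟩⟩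
    · rintro ⟨⟨hθ, -, -⟩, he⟩
      refine hθ.eq_or_eq_twistChar hψ h2 hx ?_
      rw [he, charInner_self hχ]
      exact one_ne_zero
    · have hr : resChar G θ = resChar G ψ → FS Ghat θ = 0 := fun he => by
        rw [FS_eq_half h2 hx, he, h0, zero_div]
      have ht := resChar_twistChar h2 ψ
      rintro (rfl | rfl)
      · exact ⟨⟨hψ, hr rfl, hχ⟩, rfl⟩
      · exact ⟨⟨hψ.twistChar h2, hr ht, ht ▸ hχ⟩, ht⟩

theorem ncard_setOf_not_isIrrChar_resChar :
    {χ | IsIrrChar G χ ∧ FS G χ + FSsharp G h2 χ = 0 ∧ bChar h2 x χ ≠ χ}.ncard =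
      2 * {ψ | IsIrrChar Ghat ψ ∧ FS Ghat ψ = 0 ∧ ¬ IsIrrChar G (resChar G ψ)}.ncard := by
  refine ncard_eq_two_mul (finite_setOf_isIrrChar.subset fun _ h => h.1)
    (finite_setOf_isIrrChar.subset fun _ h => h.1) (indChar h2 x) ?_ ?_
  · rintro χ ⟨h, h0, hb⟩
    exact ⟨h.indChar h2 hx hb, (FS_indChar h2 hx χ).trans h0,
      h.not_isIrrChar_resChar_indChar h2 hb⟩
  · rintro ψ ⟨hψ, h0, hr⟩
    obtain ⟨χ, hχ, hb, rfl⟩ := (hψ.isIrrChar_resChar_or_eq_indChar h2 hx).resolve_left hr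
    rw [FS_indChar h2 hx] at h0
    rw [Set.ncard_eq_two]
    refine ⟨χ, bChar h2 x χ, hb.symm, Set.ext fun θ => ⟨?_, ?_⟩⟩
    · rintro ⟨⟨hθ, -, -⟩, he⟩
      exact eq_or_eq_bChar_of_indChar_eq hθ hχ h2 he
    · rintro (rfl | rfl)
      · exact ⟨⟨hχ, h0, hb⟩, rfl⟩
      · refine ⟨⟨hχ.bChar h2 x, ?_, ?_⟩, indChar_bChar hχ.isChar h2 x⟩
        · rw [FS_bChar, FSsharp_bChar h2 hx, h0]
        · rw [bChar_bChar hχ.isChar]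
          exact hb.symm

theorem ncard_setOf_bChar_eq :
    {χ | IsIrrChar G χ ∧ FS G χ + FSsharp G h2 χ = 0 ∧ bChar h2 x χ = χ}.ncard =
      {χ | IsIrrChar G χ ∧ FS G χ = 1 ∧ FSsharp G h2 χ = -1}.ncard +
      {χ | IsIrrChar G χ ∧ FS G χ = 0 ∧ FSsharp G h2 χ = 0 ∧ bChar h2 x χ = χ}.ncard +
      {χ | IsIrrChar G χ ∧ FS G χ = -1 ∧ FSsharp G h2 χ = 1}.ncard := by
  have hfin (P : (G → ℂ) → Prop) : {χ | IsIrrChar G χ ∧ P χ}.Finite :=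
    finite_setOf_isIrrChar.subset fun _ h => h.1
  rw [← Set.ncard_union_eq _ (hfin _) (hfin _),
    ← Set.ncard_union_eq _ ((hfin _).union (hfin _)) (hfin _)]
  · congr 1
    ext χ
    constructor
    · rintro ⟨h, hf, hb⟩
      obtain ⟨-, h1 | h1⟩ | ⟨-, h1⟩ := h.FS_real_or_eq_zero
      · exact Or.inl (Or.inl ⟨h, h1, by linear_combination hf - h1⟩)
      · exact Or.inr ⟨h, h1, by linear_combination hf - h1⟩
      · exact Or.inl (Or.inr ⟨h, h1, by linear_combination hf - h1, hb⟩)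
    · have key (h : IsIrrChar G χ) (hf : FS G χ + FSsharp G h2 χ = 0) (h0 : FS G χ ≠ 0) :
          bChar h2 x χ = χ := by
        by_contra hb
        exact h0 (h.FS_eq_zero_of_bChar_ne h2 hx hb hf)
      rintro ((⟨h, h1, h3⟩ | ⟨h, h1, h3, hb⟩) | ⟨h, h1, h3⟩)
      · exact ⟨h, by simp [h1, h3], key h (by simp [h1, h3]) (by simp [h1])⟩
      · exact ⟨h, by simp [h1, h3], hb⟩
      · exact ⟨h, by simp [h1, h3], key h (by simp [h1, h3]) (by simp [h1])⟩
  · rw [Set.disjoint_left]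
    rintro χ (⟨-, h1, -⟩ | ⟨-, h1, -⟩) ⟨-, h3, -⟩ <;> rw [h1] at h3 <;> norm_num at h3
  · rw [Set.disjoint_left]
    rintro χ ⟨-, h1, -⟩ ⟨-, h3, -⟩
    rw [h1] at h3
    norm_num at h3

theorem setOf_bChar_ne :
    {χ | IsIrrChar G χ ∧ FS G χ + FSsharp G h2 χ = 0 ∧ bChar h2 x χ ≠ χ} =
      {χ | IsIrrChar G χ ∧ FS G χ = 0 ∧ FSsharp G h2 χ = 0 ∧ bChar h2 x χ ≠ χ} := by
  ext χ
  constructor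
  · rintro ⟨h, hf, hb⟩
    have h0 := h.FS_eq_zero_of_bChar_ne h2 hx hb hf
    exact ⟨h, h0, by linear_combination hf - h0, hb⟩
  · rintro ⟨h, h1, h3, hb⟩
    exact ⟨h, by simp [h1, h3], hb⟩

end Count
/-- `4·N_II + 4·N_IV + N_VII + 4·N_IX = 2·N̂_ℂ`. -/
theorem four_NII_add_four_NIV_add_NVII_add_four_NIX {Ghat : Type} [Group Ghat] [Finite Ghat]
    (G : Subgroup Ghat) (h2 : G.index = 2) (x : Ghat) (hx : x ∉ G) :
    4 * Set.ncard {χ : ↥G → ℂ | IsIrrChar ↥G χ ∧ FS ↥G χ = 1 ∧ FSsharp G h2 χ = -1} +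
      4 * Set.ncard {χ : ↥G → ℂ | IsIrrChar ↥G χ ∧ FS ↥G χ = 0 ∧ FSsharp G h2 χ = 0 ∧
        bChar h2 x χ = χ} +
      Set.ncard {χ : ↥G → ℂ | IsIrrChar ↥G χ ∧ FS ↥G χ = 0 ∧ FSsharp G h2 χ = 0 ∧
        bChar h2 x χ ≠ χ} +
      4 * Set.ncard {χ : ↥G → ℂ | IsIrrChar ↥G χ ∧ FS ↥G χ = -1 ∧ FSsharp G h2 χ = 1} =
    2 * Set.ncard {ψ : Ghat → ℂ | IsIrrChar Ghat ψ ∧ FS Ghat ψ = 0} := by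
  have hsplit : {ψ : Ghat → ℂ | IsIrrChar Ghat ψ ∧ FS Ghat ψ = 0}.ncard =
      {ψ | IsIrrChar Ghat ψ ∧ FS Ghat ψ = 0 ∧ IsIrrChar G (resChar G ψ)}.ncard +
      {ψ | IsIrrChar Ghat ψ ∧ FS Ghat ψ = 0 ∧ ¬ IsIrrChar G (resChar G ψ)}.ncard := by
    rw [← Set.ncard_union_eq (Set.disjoint_left.2 fun _ h h' => h'.2.2 h.2.2)
      (finite_setOf_isIrrChar.subset fun _ h => h.1)
      (finite_setOf_isIrrChar.subset fun _ h => h.1)]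
    congr 1
    ext ψ
    simp only [Set.mem_ofPred_eq, Set.mem_union]
    tauto
  have hres := ncard_setOf_isIrrChar_resChar G h2 hx
  have hind := ncard_setOf_not_isIrrChar_resChar G h2 hx
  rw [ncard_setOf_bChar_eq G h2 hx] at hres
  rw [setOf_bChar_ne G h2 hx] at hind
  omega
end

section
/- Let Y be a finite set of real numbers and n a natural number. Then there exists a natural number N such that: for any two multisets X and X' of cardinality n all of whose elements lie in Y, if ϖ_{3k−2}(X) = ϖ_{3k−2}(X') for every k = 1, …, N, then X = X'. -/
/-- The sum of `f` over a multiset supported in `Y`, written as a sum over `Y` weighted by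
multiplicities. -/
theorem Multiset.sum_map_eq_sum_count_mul {α R : Type*} [DecidableEq α] [CommSemiring R]
    {Y : Finset α} {X : Multiset α} (hX : ∀ q ∈ X, q ∈ Y) (f : α → R) :
    (X.map f).sum = ∑ q ∈ Y, (X.count q : R) * f q := by
  rw [Finset.sum_multiset_map_count]
  simp only [nsmul_eq_mul]
  refine Finset.sum_subset (fun q hq => hX q (Multiset.mem_toFinset.mp hq)) fun q _ hq => ?_
  rw [Multiset.count_eq_zero_of_notMem (fun h => hq (Multiset.mem_toFinset.mpr h))]
  simp

/-- A weight on a finite set whose moments of order less than the cardinality, with respect to a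
function injective on that set, all vanish is zero. -/
theorem Finset.eq_zero_of_forall_sum_mul_pow_eq_zero {α R : Type*} [CommRing R] [IsDomain R]
    {Y : Finset α} {f : α → R} (hf : Set.InjOn f Y) {v : α → R}
    (h : ∀ i < Y.card, ∑ q ∈ Y, v q * f q ^ i = 0) : ∀ q ∈ Y, v q = 0 := by
  intro q hq
  let e := Y.equivFin
  have hv : (fun j => v (e.symm j)) = 0 := by
    refine Matrix.eq_zero_of_forall_pow_sum_mul_pow_eq_zero (f := fun j => f (e.symm j))
      (hf.injective.comp e.symm.injective) fun i => ?_
    rw [← h i i.isLt, ← Finset.sum_coe_sort Y]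
    exact e.symm.sum_comp fun q : Y => v q * f q ^ (i : ℕ)
  simpa using congrFun hv (e ⟨q, hq⟩)

/-- Multisets of `n` elements from a fixed finite set `Y ⊆ ℝ` are determined by finitely
many of the power sums `ϖ_{3k-2}`. -/
theorem multiset_eq_of_powersums_3k_sub_2_eq (Y : Finset ℝ) (n : ℕ) :
    ∃ N : ℕ, ∀ X X' : Multiset ℝ, Multiset.card X = n → Multiset.card X' = n →
      (∀ q ∈ X, q ∈ Y) → (∀ q ∈ X', q ∈ Y) →
      (∀ k : ℕ, 1 ≤ k → k ≤ N →
        (X.map (fun q => q ^ (3 * k - 2))).sum = (X'.map (fun q => q ^ (3 * k - 2))).sum) →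
      X = X' := by
  refine ⟨Y.card, fun X X' hn hn' hX hX' h => ?_⟩
  have hv : ∀ q ∈ Y, ((X.count q : ℝ) - X'.count q) * q = 0 := by
    refine Finset.eq_zero_of_forall_sum_mul_pow_eq_zero (f := fun q : ℝ => q ^ 3)
      (Odd.strictMono_pow (by decide)).injective.injOn fun i hi => ?_
    have hk := h (i + 1) (by omega) (by omega)
    rw [Multiset.sum_map_eq_sum_count_mul hX, Multiset.sum_map_eq_sum_count_mul hX',
      ← sub_eq_zero, ← Finset.sum_sub_distrib] at hk
    rw [← hk]
    refine Finset.sum_congr rfl fun q _ => ?_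
    rw [show 3 * (i + 1) - 2 = 3 * i + 1 by omega]
    ring
  have hne : ∀ q : ℝ, q ≠ 0 → X.count q = X'.count q := by
    intro q hq
    by_cases hY : q ∈ Y
    · exact_mod_cast sub_eq_zero.mp ((mul_eq_zero.mp (hv q hY)).resolve_right hq)
    · rw [Multiset.count_eq_zero_of_notMem (fun hm => hY (hX q hm)),
        Multiset.count_eq_zero_of_notMem (fun hm => hY (hX' q hm))]
  have hfilter : X.filter (· ≠ 0) = X'.filter (· ≠ 0) := by
    ext q
    by_cases hq : q = 0
    · simp [hq]
    · simp [hq, hne q hq]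
  ext q
  by_cases hq : q = 0
  · have hc := congrArg Multiset.card (Multiset.filter_add_not (· ≠ (0 : ℝ)) X)
    have hc' := congrArg Multiset.card (Multiset.filter_add_not (· ≠ (0 : ℝ)) X')
    simp only [Multiset.card_add, not_not, Multiset.filter_eq', Multiset.card_replicate] at hc hc'
    rw [hfilter] at hc
    rw [hq]
    omega
  · exact hne q hq
end

section
/- For every integer m ≥ 1, the number of m-tuples (z₁, …, z_m) ∈ (G♯)^m satisfying z₁² z₂² ⋯ z_m² = 1 equals |G|^{m−1} · ∑_{χ ∈ Irr(G)} F♯(χ)^m / χ(1)^{m−2}. -/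
open scoped Classical

theorem trace_mulLeft_pi_matrix {ι : Type*} [Fintype ι] (d : ι → ℕ)
    (M : Π i, Matrix (Fin (d i)) (Fin (d i)) ℂ) :
    LinearMap.trace ℂ _ (LinearMap.mulLeft ℂ M) = ∑ i, (d i : ℂ) * (M i).trace := by
  rw [LinearMap.trace_eq_matrix_trace ℂ
    (Pi.basis fun i => Matrix.stdBasis ℂ (Fin (d i)) (Fin (d i))),
    Matrix.trace, Fintype.sum_sigma]
  refine Finset.sum_congr rfl fun i _ => ?_
  rw [Fintype.sum_prod_type, Matrix.trace, Finset.mul_sum]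
  refine Finset.sum_congr rfl fun a _ => ?_
  simp_rw [Matrix.diag_apply, LinearMap.toMatrix_apply, Pi.basis_repr, Pi.basis_apply, Matrix.stdBasis_eq_single,
    LinearMap.mulLeft_apply]
  simp [Matrix.stdBasis, Matrix.mul_single_apply_same]

theorem trace_mulLeft_monoidAlgebra {G : Type} [Group G] [Finite G] (g : G) :
    LinearMap.trace ℂ _ (LinearMap.mulLeft ℂ (MonoidAlgebra.of ℂ G g)) =
      if g = 1 then (Nat.card G : ℂ) else 0 := by
  have := Fintype.ofFinite G
  rw [LinearMap.trace_eq_matrix_trace ℂ (MonoidAlgebra.basis G ℂ), Matrix.trace]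
  simp_rw [Matrix.diag_apply, LinearMap.toMatrix_apply]
  simp [MonoidAlgebra.basis, Finsupp.single_apply]

theorem exists_regular_decomposition (G : Type) [Group G] [Finite G] :
    ∃ (n : ℕ) (V : Fin n → FDRep ℂ G), (∀ i, 0 < Module.finrank ℂ (V i)) ∧
      ∀ g, ∑ i, (Module.finrank ℂ (V i) : ℂ) * (V i).character g =
        if g = 1 then (Nat.card G : ℂ) else 0 := by
  have : Module.Finite ℂ (MonoidAlgebra ℂ G) := Module.Finite.of_basis (MonoidAlgebra.basis G ℂ)
  obtain ⟨n, d, hd, ⟨e⟩⟩ :=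
    IsSemisimpleRing.exists_algEquiv_pi_matrix_of_isAlgClosed ℂ (MonoidAlgebra ℂ G)
  let r (i : Fin n) : G →* ((Fin (d i) → ℂ) →ₗ[ℂ] (Fin (d i) → ℂ)) :=
    ((Matrix.toLinAlgEquiv' (R := ℂ) (n := Fin (d i))).toAlgHom.comp
      ((Pi.evalAlgHom ℂ _ i).comp e.toAlgHom)).toMonoidHom.comp (MonoidAlgebra.of ℂ G)
  refine ⟨n, fun i => FDRep.of (r i), fun i => ?_, fun g => ?_⟩
  · change 0 < Module.finrank ℂ (Fin (d i) → ℂ)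
    simpa using Nat.pos_of_ne_zero (hd i).out
  · rw [← trace_mulLeft_monoidAlgebra g, ← LinearMap.trace_conj' _ e.toLinearEquiv]
    have : e.toLinearEquiv.conj (LinearMap.mulLeft ℂ (MonoidAlgebra.of ℂ G g)) =
      LinearMap.mulLeft ℂ (e (MonoidAlgebra.of ℂ G g)) := by
      refine LinearMap.ext fun x => ?_
      simp [LinearEquiv.conj_apply]
    rw [this, trace_mulLeft_pi_matrix]
    refine Finset.sum_congr rfl fun i _ => ?_
    congr 1
    · change ((Module.finrank ℂ (Fin (d i) → ℂ) : ℕ) : ℂ) = _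
      simp
    · change LinearMap.trace ℂ (Fin (d i) → ℂ) (Matrix.toLin' _) = _
      exact Matrix.trace_toLin'_eq _

theorem finrank_invariants_linHom_self {G : Type} [Group G] (V : FDRep ℂ G)
    [CategoryTheory.Simple V] :
    Module.finrank ℂ (Representation.linHom V.ρ V.ρ).invariants = 1 := by
  rw [(Representation.linHom.invariantsEquivFDRepHom V V).finrank_eq,
    FDRep.finrank_hom_simple_simple, if_pos ⟨CategoryTheory.Iso.refl V⟩]

theorem mem_invariants_linHom_self {G : Type} [Group G] (V : FDRep ℂ G) {T : V →ₗ[ℂ] V}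
    (hT : ∀ g, V.ρ g * T = T * V.ρ g) : T ∈ (Representation.linHom V.ρ V.ρ).invariants := by
  intro g
  change V.ρ g * (T * V.ρ g⁻¹) = T
  rw [← mul_assoc, hT, mul_assoc, ← map_mul, mul_inv_cancel, map_one, mul_one]

theorem finrank_pos_of_simple {G : Type} [Group G] (V : FDRep ℂ G)
    [CategoryTheory.Simple V] : 0 < Module.finrank ℂ V := by
  by_contra! h
  have : Subsingleton V := Module.finrank_zero_iff.mp (Nat.le_zero.mp h)
  have := finrank_invariants_linHom_self V
  have hs : Subsingleton (V →ₗ[ℂ] V) := ⟨fun a b => LinearMap.ext fun x => Subsingleton.elim _ _⟩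
  rw [Module.finrank_zero_of_subsingleton] at this
  exact zero_ne_one this

/-- Schur's lemma, with the scalar expressed through the trace. -/
theorem eq_smul_one_of_commute {G : Type} [Group G] (V : FDRep ℂ G)
    [CategoryTheory.Simple V] {T : V →ₗ[ℂ] V} (hT : ∀ g, V.ρ g * T = T * V.ρ g) :
    T = (LinearMap.trace ℂ V T / Module.finrank ℂ V) • (1 : V →ₗ[ℂ] V) := by
  have hd : (Module.finrank ℂ V : ℂ) ≠ 0 := by exact_mod_cast (finrank_pos_of_simple V).ne'
  have h1 : (1 : V →ₗ[ℂ] V) ≠ 0 := by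
    intro h
    apply hd
    rw [← LinearMap.trace_one ℂ V, h, map_zero]
  obtain ⟨c, hc⟩ := (finrank_eq_one_iff_of_nonzero'
    (⟨1, mem_invariants_linHom_self V fun g => by simp⟩ :
      (Representation.linHom V.ρ V.ρ).invariants) (by simpa [Subtype.ext_iff] using h1)).mp
    (finrank_invariants_linHom_self V) ⟨T, mem_invariants_linHom_self V hT⟩
  have hc' : c • (1 : V →ₗ[ℂ] V) = T := congrArg Subtype.val hc
  rw [← hc', map_smul, LinearMap.trace_one, smul_eq_mul, mul_div_cancel_right₀ _ hd]

theorem sum_prod_ofFn_eq_sum_pow {R S : Type*} [Semiring R] [Fintype S] (f : S → R) (m : ℕ) :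
    ∑ z : Fin m → S, (List.ofFn fun i => f (z i)).prod = (∑ s, f s) ^ m := by
  induction m with
  | zero => simp
  | succ m ih =>
    rw [← (Fin.consEquiv fun _ => S).sum_comp, Fintype.sum_prod_type, pow_succ', ← ih,
      Finset.sum_mul_sum]
    simp [List.ofFn_succ, Fin.consEquiv]

/-- The sum of an irreducible character over all words of length `m` in a conjugation-invariant
family. -/
theorem sum_character_words {G S : Type} [Group G] [Fintype S] (V : FDRep ℂ G)
    [CategoryTheory.Simple V] (f : S → G)
    (hf : ∀ g, ∃ σ : Equiv.Perm S, ∀ s, f (σ s) = g * f s * g⁻¹) (m : ℕ) :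
    ∑ z : Fin m → S, V.character (List.ofFn fun i => f (z i)).prod =
      ((∑ s, V.character (f s)) / Module.finrank ℂ V) ^ m * Module.finrank ℂ V := by
  have hT : ∀ g, V.ρ g * (∑ s, V.ρ (f s)) = (∑ s, V.ρ (f s)) * V.ρ g := by
    intro g
    obtain ⟨σ, hσ⟩ := hf g
    rw [Finset.mul_sum, Finset.sum_mul, ← Equiv.sum_comp σ (fun s => V.ρ (f s) * V.ρ g)]
    refine Finset.sum_congr rfl fun s _ => ?_
    rw [hσ, ← map_mul, ← map_mul, inv_mul_cancel_right]
  have hsum : ∑ s, V.character (f s) = LinearMap.trace ℂ V (∑ s, V.ρ (f s)) := by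
    simp [FDRep.character]
  have key := sum_prod_ofFn_eq_sum_pow (fun s => V.ρ (f s)) m
  rw [eq_smul_one_of_commute V hT, smul_pow, one_pow, ← hsum] at key
  have := congrArg (LinearMap.trace ℂ V) key
  rw [map_smul, LinearMap.trace_one, map_sum, smul_eq_mul] at this
  rw [← this]
  refine Finset.sum_congr rfl fun z _ => ?_
  rw [FDRep.character, map_list_prod, List.map_ofFn]
  rfl

theorem exists_irreducible_characters (G : Type) [Group G] [Finite G] :
    ∃ (n : ℕ) (V : Fin n → FDRep ℂ G), (∀ i, CategoryTheory.Simple (V i)) ∧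
      Function.Injective (fun i => (V i).character) ∧
      {χ : G → ℂ | IsIrrChar G χ} = Set.range (fun i => (V i).character) ∧
      ∀ g, ∑ i, (Module.finrank ℂ (V i) : ℂ) * (V i).character g =
        if g = 1 then (Nat.card G : ℂ) else 0 := by
  have := Fintype.ofFinite G
  have hG : (Nat.card G : ℂ) ≠ 0 := by exact_mod_cast Nat.card_pos.ne'
  have := invertibleOfNonzero hG
  obtain ⟨n, V, hd, hreg⟩ := exists_regular_decomposition G
  have hmul (W : FDRep ℂ G) : Module.finrank ℂ W =
      ∑ i, Module.finrank ℂ (V i) * Module.finrank ℂ (W ⟶ V i) := by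
    rw [← Nat.cast_inj (R := ℂ)]
    push_cast
    simp_rw [← FDRep.scalar_product_char_eq_finrank_equivariant, Finset.mul_sum]
    rw [Finset.sum_comm]
    have (g : G) : ∑ i, (Module.finrank ℂ (V i) : ℂ) *
        ((Nat.card G : ℂ)⁻¹ * ((V i).character g * W.character g⁻¹)) =
        if g = 1 then W.character g⁻¹ else 0 := by
      calc _ = (Nat.card G : ℂ)⁻¹ * W.character g⁻¹ *
            ∑ i, (Module.finrank ℂ (V i) : ℂ) * (V i).character g := by
              rw [Finset.mul_sum]
              exact Finset.sum_congr rfl fun i _ => by ring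
        _ = _ := by
          rw [hreg]
          split_ifs
          · field_simp
          · simp
    simp_rw [this]
    simp
  have hself (i) : 0 < Module.finrank ℂ (V i ⟶ V i) := by
    rw [← (Representation.linHom.invariantsEquivFDRepHom (V i) (V i)).finrank_eq,
      Module.finrank_pos_iff_exists_ne_zero]
    refine ⟨⟨1, mem_invariants_linHom_self (V i) fun g => by simp⟩, fun h => ?_⟩
    have h1 : (1 : V i →ₗ[ℂ] V i) = 0 := congrArg Subtype.val h
    have := LinearMap.trace_one ℂ (V i)
    rw [h1, map_zero] at this
    exact (hd i).ne (by exact_mod_cast this)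
  have hle (i) : Module.finrank ℂ (V i) * Module.finrank ℂ (V i ⟶ V i) ≤
      Module.finrank ℂ (V i) * 1 := by
    rw [mul_one]
    conv_rhs => rw [hmul (V i)]
    exact Finset.single_le_sum
      (f := fun j => Module.finrank ℂ (V j) * Module.finrank ℂ (V i ⟶ V j))
      (fun _ _ => Nat.zero_le _) (Finset.mem_univ i)
  have hone (i) : Module.finrank ℂ (V i ⟶ V i) = 1 :=
    le_antisymm (Nat.le_of_mul_le_mul_left (hle i) (hd i)) (hself i)
  have hsimple (i) : CategoryTheory.Simple (V i) :=
    (FDRep.simple_iff_end_is_rank_one (V i)).mpr (hone i)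
  have hzero (i j) (hij : i ≠ j) : Module.finrank ℂ (V i ⟶ V j) = 0 := by
    have h := hmul (V i)
    rw [← Finset.add_sum_erase _ _ (Finset.mem_univ i), hone, mul_one] at h
    have h0 := (Finset.sum_eq_zero_iff.mp (Nat.add_eq_left.mp h.symm)) j (by simp [hij.symm])
    exact (Nat.mul_eq_zero.mp h0).resolve_left (hd j).ne'
  refine ⟨n, V, hsimple, fun i j hij => ?_, ?_, hreg⟩
  · by_contra hne
    have h1 := FDRep.scalar_product_char_eq_finrank_equivariant (V i) (V j)
    have h2 := FDRep.scalar_product_char_eq_finrank_equivariant (V i) (V i)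
    simp only at hij
    rw [← hij, h2, hone, hzero i j hne] at h1
    simp at h1
  · ext χ
    constructor
    · rintro ⟨W, hW, rfl⟩
      have h := hmul W
      have hpos := finrank_pos_of_simple W
      obtain ⟨i, -, hi⟩ := Finset.exists_ne_zero_of_sum_ne_zero (h ▸ hpos.ne')
      have := hsimple i
      rw [FDRep.finrank_hom_simple_simple] at hi
      by_cases hiso : Nonempty (W ≅ V i)
      · exact ⟨i, (FDRep.char_iso hiso.some).symm⟩
      · simp [hiso] at hi
    · rintro ⟨i, rfl⟩
      exact ⟨V i, hsimple i, rfl⟩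

/-- Frobenius' formula for the number of words of length `m` in a conjugation-invariant family
whose product is trivial. -/
theorem card_mul_card_trivial_words {G S : Type} [Group G] [Finite G] [Fintype S] (f : S → G)
    (hf : ∀ g, ∃ σ : Equiv.Perm S, ∀ s, f (σ s) = g * f s * g⁻¹) (m : ℕ) :
    (Nat.card G : ℂ) * Nat.card {z : Fin m → S // (List.ofFn fun i => f (z i)).prod = 1} =
      ∑ᶠ χ ∈ {χ : G → ℂ | IsIrrChar G χ}, ((∑ s, χ (f s)) / χ 1) ^ m * χ 1 ^ 2 := by
  obtain ⟨n, V, hV, hinj, hrange, hreg⟩ := exists_irreducible_characters G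
  rw [hrange, finsum_mem_range hinj, finsum_eq_sum_of_fintype,
    Nat.card_eq_fintype_card (α := {z : Fin m → S // _}), Fintype.card_subtype, Finset.card_filter]
  push_cast
  rw [Finset.mul_sum]
  calc _ = ∑ z : Fin m → S, ∑ i, (Module.finrank ℂ (V i) : ℂ) *
        (V i).character (List.ofFn fun j => f (z j)).prod := by
        refine Finset.sum_congr rfl fun z _ => ?_
        rw [hreg]
        simp
    _ = _ := by
        rw [Finset.sum_comm]
        refine Finset.sum_congr rfl fun i _ => ?_
        have := hV i
        rw [← Finset.mul_sum, sum_character_words (V i) f hf, FDRep.char_one]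
        ring

theorem IsIrrChar.map_one_ne_zero {G : Type} [Group G] {χ : G → ℂ} (h : IsIrrChar G χ) :
    χ 1 ≠ 0 := by
  obtain ⟨V, hV, rfl⟩ := h
  rw [FDRep.char_one]
  exact_mod_cast (finrank_pos_of_simple V).ne'

/-- The number of solutions of `z₁² ⋯ z_m² = 1` with all `zᵢ ∈ Ĝ \ G` equals
`|G|^(m-1) · ∑_{χ ∈ Irr(G)} F♯(χ)^m / χ(1)^(m-2)`. -/
theorem count_coset_square_words {Ghat : Type} [Group Ghat] [Finite Ghat] (G : Subgroup Ghat)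
    (h2 : G.index = 2) (m : ℕ) (hm : 1 ≤ m) :
    (Set.ncard {z : Fin m → Ghat | (∀ i, z i ∉ G) ∧
        (List.ofFn fun i => (z i) ^ 2).prod = 1} : ℂ) =
      (Nat.card ↥G : ℂ) ^ ((m : ℤ) - 1) *
        ∑ᶠ χ ∈ {χ : ↥G → ℂ | IsIrrChar ↥G χ},
          FSsharp G h2 χ ^ m / χ 1 ^ ((m : ℤ) - 2) := by
  have := Fintype.ofFinite Ghat
  let f : {z : Ghat // z ∉ G} → G := fun z => ⟨z.1 ^ 2, Subgroup.sq_mem_of_index_two h2 z.1⟩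
  have hf (g : G) : ∃ σ : Equiv.Perm {z : Ghat // z ∉ G}, ∀ s, f (σ s) = g * f s * g⁻¹ := by
    refine ⟨(MulAut.conj (g : Ghat)).toEquiv.subtypeEquiv fun a => ?_, fun s => ?_⟩
    · change a ∉ G ↔ (g : Ghat) * a * (g : Ghat)⁻¹ ∉ G
      rw [G.mul_mem_cancel_right (G.inv_mem g.2), G.mul_mem_cancel_left g.2]
    · apply Subtype.ext
      change ((g : Ghat) * s * (g : Ghat)⁻¹) ^ 2 = g * (s : Ghat) ^ 2 * (g : Ghat)⁻¹
      rw [conj_pow]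
  have hcard : Set.ncard {z : Fin m → Ghat | (∀ i, z i ∉ G) ∧
      (List.ofFn fun i => (z i) ^ 2).prod = 1} =
      Nat.card {z : Fin m → {z : Ghat // z ∉ G} // (List.ofFn fun i => f (z i)).prod = 1} := by
    have hprod (z : Fin m → {z : Ghat // z ∉ G}) : (List.ofFn fun i => f (z i)).prod = 1 ↔
        (List.ofFn fun i => (z i : Ghat) ^ 2).prod = 1 := by
      rw [← G.subtype_injective.eq_iff, map_list_prod, List.map_ofFn, map_one]
      rfl
    rw [← Nat.card_coe_set_eq]
    exact Nat.card_congr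
      { toFun := fun z => ⟨fun i => ⟨z.1 i, z.2.1 i⟩, (hprod _).mpr z.2.2⟩
        invFun := fun z => ⟨fun i => z.1 i, fun i => (z.1 i).2, (hprod _).mp z.2⟩
        left_inv := fun _ => rfl
        right_inv := fun _ => rfl }
  have hG : (Nat.card G : ℂ) ≠ 0 := by exact_mod_cast Nat.card_pos.ne'
  have hFS (χ : G → ℂ) : FSsharp G h2 χ = (∑ s, χ (f s)) / (Nat.card G : ℂ) := by
    rw [FSsharp, ← finsum_set_coe_eq_finsum_mem, finsum_eq_sum_of_fintype]
    rfl
  rw [hcard]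
  apply mul_left_cancel₀ hG
  rw [card_mul_card_trivial_words f hf, ← mul_assoc, ← zpow_one_add₀ hG, mul_finsum_mem]
  refine finsum_mem_congr rfl fun χ hχ => ?_
  have h1 := IsIrrChar.map_one_ne_zero hχ
  rw [hFS, add_sub_cancel, zpow_natCast, zpow_sub₀ h1, zpow_natCast, div_pow, div_pow]
  field_simp
end

section
/- For every integer n ≥ 1, the number of tuples (y₁, …, y_{2n}) ∈ G^{2n}, (z₁, …, z_n) ∈ (G♯)^n satisfying y₁² y₂² z₁² y₃² y₄² z₂² ⋯ y_{2n−1}² y_{2n}² z_n² = 1 equals |G|^{3n−1} · ∑_{χ ∈ Irr(G)} F(χ)^{2n} F♯(χ)^n / χ(1)^{3n−2}. -/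
open scoped Classical

open Module CategoryTheory

theorem Representation.eq_trace_div_smul_one_of_finrank_eq_one {G k V : Type*} [Monoid G] [Field k]
    [CharZero k] [AddCommGroup V] [Module k V] [FiniteDimensional k V] {ρ : Representation k G V}
    (h : finrank k (ρ.IntertwiningMap ρ) = 1) {A : V →ₗ[k] V} (hA : ∀ g, Commute A (ρ g)) :
    A = (LinearMap.trace k V A / finrank k V) • 1 := by
  rcases subsingleton_or_nontrivial V with hV | hV
  · exact Subsingleton.elim _ _
  have hid : IntertwiningMap.id ρ ≠ 0 := by
    intro h0
    obtain ⟨v, hv⟩ := exists_ne (0 : V)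
    exact hv (by simpa using congr($h0 v))
  obtain ⟨c, hc⟩ := (finrank_eq_one_iff_of_nonzero' _ hid).mp h ⟨A, fun g => (hA g).eq⟩
  have hA' : A = c • 1 := by
    ext v
    simpa using congr($hc v).symm
  have hd : (finrank k V : k) ≠ 0 := Nat.cast_ne_zero.mpr finrank_pos.ne'
  rw [hA', map_smul, LinearMap.trace_one, smul_eq_mul, mul_div_cancel_right₀ _ hd]

theorem FDRep.finrank_intertwiningMap_eq_one {G : Type} [Group G] [Finite G] (V : FDRep ℂ G)
    [Simple V] : finrank ℂ (Representation.IntertwiningMap V.ρ V.ρ) = 1 := by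
  have := Fintype.ofFinite G
  have : Invertible (Nat.card G : ℂ) := invertibleOfNonzero (NeZero.ne _)
  have h1 := V.scalar_product_char_eq_finrank_equivariant V
  rw [finrank_endomorphism_simple_eq_one] at h1
  have h2 := Representation.card_inv_mul_sum_char_mul_char_eq_finrank V.ρ V.ρ
  exact_mod_cast h2.symm.trans h1

theorem FDRep.char_one_ne_zero {G : Type} [Group G] [Finite G] (V : FDRep ℂ G) [Simple V] :
    V.character 1 ≠ 0 := by
  have : Nontrivial V := by
    by_contra h
    rw [not_nontrivial_iff_subsingleton] at h
    have : Subsingleton (Representation.IntertwiningMap V.ρ V.ρ) :=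
      ⟨fun f g => by ext v; exact Subsingleton.elim _ _⟩
    simpa [finrank_zero_of_subsingleton] using V.finrank_intertwiningMap_eq_one
  rw [FDRep.char_one, Nat.cast_ne_zero]
  exact finrank_pos.ne'

theorem IsIrrChar.card_inv_mul_sum_mul {G : Type} [Group G] [Fintype G] {χ ψ : G → ℂ}
    (hχ : IsIrrChar G χ) (hψ : IsIrrChar G ψ) :
    (Nat.card G : ℂ)⁻¹ * ∑ g, χ g * ψ g⁻¹ = if χ = ψ then 1 else 0 := by
  have : Invertible (Nat.card G : ℂ) := invertibleOfNonzero (NeZero.ne _)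
  obtain ⟨V, hV, rfl⟩ := hχ
  obtain ⟨W, hW, rfl⟩ := hψ
  by_cases h : V.character = W.character
  · rw [← h, FDRep.char_orthonormal V V, if_pos rfl, if_pos ⟨Iso.refl V⟩]
  · rw [FDRep.char_orthonormal V W, if_neg h, if_neg]
    exact fun ⟨e⟩ => h (FDRep.char_iso e)

section
open scoped MonoidAlgebra

/-- The representation of `G` on a `k[G]`-module. -/
noncomputable def MonoidAlgebra.moduleRepresentation (k G M : Type*) [Field k] [Monoid G]
    [AddCommGroup M] [Module k M] [Module k[G] M] [IsScalarTower k k[G] M] :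
    Representation k G M :=
  (Algebra.lsmul k k M : k[G] →ₐ[k] M →ₗ[k] M).toMonoidHom.comp (MonoidAlgebra.of k G)

theorem MonoidAlgebra.moduleRepresentation_apply {k G M : Type*} [Field k] [Monoid G]
    [AddCommGroup M] [Module k M] [Module k[G] M] [IsScalarTower k k[G] M] (g : G) (m : M) :
    moduleRepresentation k G M g m = MonoidAlgebra.single g (1 : k) • m := rfl

theorem MonoidAlgebra.isIrreducible_moduleRepresentation (k G M : Type*) [Field k] [Monoid G]
    [AddCommGroup M] [Module k M] [Module k[G] M] [IsScalarTower k k[G] M] [IsSimpleModule k[G] M] :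
    (moduleRepresentation k G M).IsIrreducible := by
  rw [Representation.irreducible_iff_isSimpleModule_asModule]
  have hsmul (a : k[G]) (m : M) : (moduleRepresentation k G M).asModuleEquiv.symm (a • m) =
      a • (moduleRepresentation k G M).asModuleEquiv.symm m := by
    induction a using MonoidAlgebra.induction_linear with
    | zero => simp
    | add x y hx hy => simp [add_smul, hx, hy]
    | single g a =>
      rw [← mul_one a, ← smul_eq_mul, ← MonoidAlgebra.smul_single, smul_assoc, smul_assoc, map_smul,
        ← moduleRepresentation_apply, Representation.asModuleEquiv_symm_map_rho]
      rfl
  let e : M ≃ₗ[k[G]] (moduleRepresentation k G M).asModule :=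
    { (moduleRepresentation k G M).asModuleEquiv.symm with
      map_smul' := hsmul }
  exact IsSimpleModule.congr e.symm

theorem isIrrChar_moduleRepresentation (G M : Type) [Group G] [Finite G] [AddCommGroup M]
    [Module ℂ M] [Module ℂ[G] M] [IsScalarTower ℂ ℂ[G] M] [FiniteDimensional ℂ M]
    [IsSimpleModule ℂ[G] M] :
    IsIrrChar G (MonoidAlgebra.moduleRepresentation ℂ G M).character := by
  have := Fintype.ofFinite G
  have : Invertible (Nat.card G : ℂ) := invertibleOfNonzero (NeZero.ne _)
  have := MonoidAlgebra.isIrreducible_moduleRepresentation ℂ G M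
  refine ⟨FDRep.of (MonoidAlgebra.moduleRepresentation ℂ G M), ?_, rfl⟩
  rw [FDRep.simple_iff_char_is_norm_one]
  have h := Representation.char_orthonormal (MonoidAlgebra.moduleRepresentation ℂ G M)
    (MonoidAlgebra.moduleRepresentation ℂ G M)
  rw [if_pos ⟨.refl _⟩, inv_mul_eq_one₀ (NeZero.ne _)] at h
  exact h.symm

theorem MonoidAlgebra.trace_moduleRepresentation_self (k G : Type*) [Field k] [Group G]
    [Finite G] (g : G) :
    LinearMap.trace k k[G] (moduleRepresentation k G k[G] g) =
      if g = 1 then (Nat.card G : k) else 0 := by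
  have := Fintype.ofFinite G
  rw [LinearMap.trace_eq_matrix_trace k (MonoidAlgebra.basis G k), Matrix.trace]
  have h (x : G) : (MonoidAlgebra.basis G k).repr (MonoidAlgebra.single (g * x) (1 : k)) x =
      if g = 1 then 1 else 0 := by
    rw [← MonoidAlgebra.basis_apply, Basis.repr_self, Finsupp.single_apply]
    simp
  simp [LinearMap.toMatrix_apply, moduleRepresentation_apply, h]

/-- The regular character is a sum of irreducible characters. -/
theorem exists_isIrrChar_sum_eq (G : Type) [Group G] [Finite G] :
    ∃ (ι : Type) (_ : Fintype ι) (c : ι → G → ℂ), (∀ i, IsIrrChar G (c i)) ∧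
      ∀ g, ∑ i, c i g = if g = 1 then (Nat.card G : ℂ) else 0 := by
  obtain ⟨s, hind, hsup, hs⟩ := IsSemisimpleModule.exists_sSupIndep_sSup_simples_eq_top ℂ[G] ℂ[G]
  have hfin : Finite s := WellFoundedGT.finite_of_sSupIndep hind
  have := Fintype.ofFinite s
  have (N : s) : IsSimpleModule ℂ[G] N.1 := hs N.1 N.2
  have hint : DirectSum.IsInternal fun N : s => N.1.restrictScalars ℂ :=
    DirectSum.isInternal_submodule_of_iSupIndep_of_iSup_eq_top (A := fun N : s => N.1)
     ((sSupIndep_iff _).mp hind) (by rw [← hsup, sSup_eq_iSup'])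
  have (N : s) : FiniteDimensional ℂ N.1 :=
    inferInstanceAs (FiniteDimensional ℂ (N.1.restrictScalars ℂ))
  refine ⟨s, inferInstance, fun N => (MonoidAlgebra.moduleRepresentation ℂ G N.1).character,
    fun N => isIrrChar_moduleRepresentation G N.1, fun g => ?_⟩
  rw [← MonoidAlgebra.trace_moduleRepresentation_self, LinearMap.trace_eq_sum_trace_restrict hint]
  · rfl
  · intro N x hx
    exact N.1.smul_mem _ hx

end

/-- Irreducible characters are finitely many, and satisfy column orthogonality at the identity. -/
theorem exists_finset_isIrrChar (G : Type) [Group G] [Finite G] :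
    ∃ S : Finset (G → ℂ), (∀ χ, χ ∈ S ↔ IsIrrChar G χ) ∧
      ∀ g, ∑ χ ∈ S, χ 1 * χ g = if g = 1 then (Nat.card G : ℂ) else 0 := by
  have := Fintype.ofFinite G
  obtain ⟨ι, _, c, hc, hsum⟩ := exists_isIrrChar_sum_eq G
  have hmult (χ : G → ℂ) (hχ : IsIrrChar G χ) : ({i | c i = χ} : Finset ι).card = χ 1 := by
    have h : (Nat.card G : ℂ)⁻¹ * ∑ g, (∑ i, c i g) * χ g⁻¹ = χ 1 := by
      simp [hsum]
    simp_rw [← h, Finset.sum_mul]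
    rw [Finset.sum_comm, Finset.mul_sum, Finset.sum_congr rfl fun i _ =>
      (hc i).card_inv_mul_sum_mul hχ]
    simp
  have hne (χ : G → ℂ) (hχ : IsIrrChar G χ) : χ 1 ≠ 0 := by
    obtain ⟨V, hV, rfl⟩ := hχ
    exact V.char_one_ne_zero
  refine ⟨Finset.univ.image c, fun χ => ⟨?_, fun hχ => ?_⟩, fun g => ?_⟩
  · rw [Finset.mem_image]
    rintro ⟨i, -, rfl⟩
    exact hc i
  · have h := hne χ hχ
    rw [← hmult χ hχ, Nat.cast_ne_zero, Finset.card_ne_zero] at h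
    obtain ⟨i, hi⟩ := h
    exact Finset.mem_image.mpr ⟨i, Finset.mem_univ i, by simpa using hi⟩
  · rw [← hsum, ← Finset.sum_fiberwise_of_maps_to fun i hi => Finset.mem_image_of_mem c hi]
    refine Finset.sum_congr rfl fun χ hχ => ?_
    obtain ⟨j, -, rfl⟩ := Finset.mem_image.mp hχ
    rw [← hmult _ (hc j), ← nsmul_eq_mul, ← Finset.sum_const]
    exact Finset.sum_congr rfl fun i hi => by rw [(Finset.mem_filter.mp hi).2]

theorem sum_prod_ofFn_eq_pow {R T : Type*} [Semiring R] [Fintype T] (f : T → R) (n : ℕ) :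
    ∑ w : Fin n → T, (List.ofFn fun k => f (w k)).prod = (∑ t, f t) ^ n := by
  induction n with
  | zero => simp
  | succ n ih =>
    rw [pow_succ', ← ih, Finset.sum_mul_sum, ← Fintype.sum_prod_type',
      ← (Fin.consEquiv fun _ => T).sum_comp]
    simp [Fin.consEquiv, List.ofFn_succ]

/-- If the family `a` is stable under conjugation, then `∑ t, ρ (a t)` is scalar on an irreducible
representation `ρ`. -/
theorem FDRep.sum_rho_eq_smul_one {G : Type} [Group G] [Finite G] (V : FDRep ℂ G) [Simple V]
    {T : Type*} [Fintype T] (a : T → G) (e : G → T ≃ T)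
    (ha : ∀ g t, a (e g t) = g * a t * g⁻¹) :
    ∑ t, V.ρ (a t) = ((∑ t, V.character (a t)) / V.character 1) • 1 := by
  have h := Representation.eq_trace_div_smul_one_of_finrank_eq_one
    V.finrank_intertwiningMap_eq_one (A := ∑ t, V.ρ (a t)) fun g => by
      rw [commute_iff_eq, Finset.mul_sum, ← (e g).sum_comp, Finset.sum_mul]
      simp_rw [ha, ← map_mul, inv_mul_cancel_right]
  rw [h, map_sum, FDRep.char_one]
  rfl

theorem card_prod_ofFn_eq_one {G : Type} [Group G] [Finite G] {T : Type*} [Fintype T]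
    (a : T → G) (n : ℕ)
    (c : (G → ℂ) → ℂ)
    (h : ∀ V : FDRep ℂ G, Simple V → ∑ t, V.ρ (a t) = c V.character • 1) :
    (Nat.card {w : Fin n → T | (List.ofFn fun k => a (w k)).prod = 1} : ℂ) =
      (Nat.card G : ℂ)⁻¹ * ∑ᶠ χ ∈ {χ : G → ℂ | IsIrrChar G χ}, χ 1 ^ 2 * c χ ^ n := by
  obtain ⟨S, hS, hdelta⟩ := exists_finset_isIrrChar G
  have hset : {χ : G → ℂ | IsIrrChar G χ} = S := by
    ext χ
    simp [hS]
  have hχ (χ : G → ℂ) (hχ : χ ∈ S) :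
      χ 1 ^ 2 * c χ ^ n = ∑ w : Fin n → T, χ 1 * χ (List.ofFn fun k => a (w k)).prod := by
    obtain ⟨V, hV, rfl⟩ := (hS χ).mp hχ
    have hw (w : Fin n → T) : V.character (List.ofFn fun k => a (w k)).prod =
        LinearMap.trace ℂ V (List.ofFn fun k => V.ρ (a (w k))).prod := by
      rw [FDRep.character, map_list_prod, List.map_ofFn]
      rfl
    simp_rw [hw, ← Finset.mul_sum, ← map_sum, sum_prod_ofFn_eq_pow (fun t => V.ρ (a t)), h V hV]
    rw [smul_pow, one_pow, map_smul, LinearMap.trace_one, FDRep.char_one, smul_eq_mul]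
    ring
  rw [hset, finsum_mem_coe_finset, Finset.sum_congr rfl hχ, Finset.sum_comm]
  simp_rw [hdelta]
  rw [Finset.sum_ite, Finset.sum_const_zero, add_zero, Finset.sum_const, nsmul_eq_mul,
    mul_comm, mul_assoc, mul_inv_cancel₀ (NeZero.ne _), mul_one, Set.coe_ofPred,
    Nat.card_eq_fintype_card,
    Fintype.card_subtype]

/-- The value in `G` of the word `y₁²y₂²z²` with `y₁, y₂ ∈ G` and `z ∈ Ghat \ G`. -/
def mixedSquare {Ghat : Type} [Group Ghat] {G : Subgroup Ghat} (h2 : G.index = 2)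
    (t : (G × G) × {z : Ghat // z ∉ G}) : G :=
  t.1.1 ^ 2 * t.1.2 ^ 2 * ⟨(t.2 : Ghat) ^ 2, Subgroup.sq_mem_of_index_two h2 t.2.1⟩

theorem sum_rho_mixedSquare_eq_smul_one {Ghat : Type} [Group Ghat] [Fintype Ghat]
    {G : Subgroup Ghat}
    (h2 : G.index = 2) (V : FDRep ℂ G) [Simple V] :
    ∑ t, V.ρ (mixedSquare h2 t) =
      ((Nat.card G : ℂ) ^ 3 * FS G V.character ^ 2 * FSsharp G h2 V.character /
        V.character 1 ^ 3) • 1 := by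
  have hconj (g : G) (z : Ghat) : z ∉ G ↔ (MulAut.conj (g : Ghat)).toEquiv z ∉ G := by
    simp [G.mul_mem_cancel_left g.2, G.mul_mem_cancel_right (G.inv_mem g.2)]
  have hcard : (Nat.card G : ℂ) ≠ 0 := NeZero.ne _
  have hy := FDRep.sum_rho_eq_smul_one V (fun y : G => y ^ 2) (fun g => (MulAut.conj g).toEquiv)
    fun g y => by simp [conj_pow]
  have hz := FDRep.sum_rho_eq_smul_one V
    (fun z : {z : Ghat // z ∉ G} => (⟨(z : Ghat) ^ 2, Subgroup.sq_mem_of_index_two h2 z.1⟩ : G))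
    (fun g => (MulAut.conj (g : Ghat)).toEquiv.subtypeEquiv (hconj g))
    fun g z => by ext; simp [conj_pow]
  have hFS : ∑ y : G, V.character (y ^ 2) = Nat.card G * FS G V.character := by
    rw [FS, finsum_eq_sum_of_fintype, mul_div_cancel₀ _ hcard]
  have hFSs : ∑ z : {z : Ghat // z ∉ G},
      V.character ⟨(z : Ghat) ^ 2, Subgroup.sq_mem_of_index_two h2 z.1⟩ =
        Nat.card G * FSsharp G h2 V.character := by
    rw [FSsharp, ← finsum_set_coe_eq_finsum_mem, mul_div_cancel₀ _ hcard]
    exact (finsum_eq_sum_of_fintype _).symm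
  rw [hFS] at hy
  rw [hFSs] at hz
  simp_rw [mixedSquare, map_mul, Fintype.sum_prod_type, ← Finset.mul_sum, hz,
    ← Finset.sum_mul, ← Finset.mul_sum, ← Finset.sum_mul, hy]
  simp only [smul_mul_smul_comm, mul_one]
  congr 1
  ring

/-- Grouping the variables of the mixed square word block by block. -/
def mixedSquareEquiv {Ghat : Type} [Group Ghat] (G : Subgroup Ghat) (n : ℕ) :
    {yz : (Fin (2 * n) → Ghat) × (Fin n → Ghat) // (∀ i, yz.1 i ∈ G) ∧ ∀ j, yz.2 j ∉ G} ≃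
      (Fin n → (G × G) × {z : Ghat // z ∉ G}) where
  toFun yz k := ((⟨yz.1.1 ⟨2 * k.1, by omega⟩, yz.2.1 _⟩,
      ⟨yz.1.1 ⟨2 * k.1 + 1, by omega⟩, yz.2.1 _⟩),
    ⟨yz.1.2 k, yz.2.2 k⟩)
  invFun w := ⟨(fun i => if i.1 % 2 = 0 then (w ⟨i.1 / 2, by omega⟩).1.1
      else (w ⟨i.1 / 2, by omega⟩).1.2, fun k => (w k).2.1), fun i => by
        dsimp only
        split_ifs <;> exact SetLike.coe_mem _, fun k => (w k).2.2⟩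
  left_inv := by
    rintro ⟨⟨y, z⟩, hy, hz⟩
    simp only [Subtype.mk.injEq, Prod.mk.injEq, and_true]
    funext i
    split_ifs with h <;> congr 1 <;> ext1 <;> dsimp only <;> omega
  right_inv w := by
    funext k
    have h (k : ℕ) : (2 * k + 1) / 2 = k := by omega
    simp [h, Nat.add_mod]

/-- The number of solutions of `y₁²y₂²z₁² ⋯ y_{2n-1}²y_{2n}²z_n² = 1` with all `yᵢ ∈ G` and
all `zⱼ ∈ Ĝ \ G` equals `|G|^(3n-1) · ∑_{χ ∈ Irr(G)} F(χ)^(2n) F♯(χ)^n / χ(1)^(3n-2)`. -/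
theorem count_mixed_square_words {Ghat : Type} [Group Ghat] [Finite Ghat] (G : Subgroup Ghat)
    (h2 : G.index = 2) (n : ℕ) (hn : 1 ≤ n) :
    (Set.ncard {yz : (Fin (2 * n) → Ghat) × (Fin n → Ghat) |
        (∀ i, yz.1 i ∈ G) ∧ (∀ j, yz.2 j ∉ G) ∧
        (List.ofFn fun k : Fin n =>
          (yz.1 ⟨2 * k.1, by omega⟩) ^ 2 * (yz.1 ⟨2 * k.1 + 1, by omega⟩) ^ 2 *
            (yz.2 k) ^ 2).prod = 1} : ℂ) =
      (Nat.card ↥G : ℂ) ^ (3 * n - 1) *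
        ∑ᶠ χ ∈ {χ : ↥G → ℂ | IsIrrChar ↥G χ},
          FS ↥G χ ^ (2 * n) * FSsharp G h2 χ ^ n / χ 1 ^ (3 * n - 2) := by
  have := Fintype.ofFinite Ghat
  have hcount := card_prod_ofFn_eq_one (mixedSquare h2) n
    (fun χ => (Nat.card G : ℂ) ^ 3 * FS G χ ^ 2 * FSsharp G h2 χ / χ 1 ^ 3)
    fun V hV => sum_rho_mixedSquare_eq_smul_one h2 V
  have hN : Set.ncard {yz : (Fin (2 * n) → Ghat) × (Fin n → Ghat) |
        (∀ i, yz.1 i ∈ G) ∧ (∀ j, yz.2 j ∉ G) ∧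
        (List.ofFn fun k : Fin n =>
          (yz.1 ⟨2 * k.1, by omega⟩) ^ 2 * (yz.1 ⟨2 * k.1 + 1, by omega⟩) ^ 2 *
            (yz.2 k) ^ 2).prod = 1} =
      Nat.card {w : Fin n → (G × G) × {z : Ghat // z ∉ G} |
        (List.ofFn fun k => mixedSquare h2 (w k)).prod = 1} := by
    rw [← Nat.card_coe_set_eq]
    simp_rw [← and_assoc]
    refine Nat.card_congr ((Equiv.subtypeSubtypeEquivSubtypeInter _ _).symm.trans
      ((mixedSquareEquiv G n).subtypeEquiv fun yz => ?_))
    rw [Set.mem_ofPred_eq, ← G.subtype_injective.eq_iff, map_one, map_list_prod, List.map_ofFn]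
    rfl
  rw [hN, hcount, mul_finsum_mem, mul_finsum_mem]
  refine finsum_mem_congr rfl fun χ hχ => ?_
  have hχ1 : χ 1 ≠ 0 := by
    obtain ⟨V, hV, rfl⟩ := hχ
    exact V.char_one_ne_zero
  have hcard : (Nat.card G : ℂ) ≠ 0 := NeZero.ne _
  obtain ⟨m, rfl⟩ := Nat.exists_eq_add_of_le' hn
  rw [show 3 * (m + 1) - 1 = 3 * m + 2 by omega, show 3 * (m + 1) - 2 = 3 * m + 1 by omega,
    div_pow, ← pow_mul (χ 1), show 3 * (m + 1) = 3 * m + 3 by omega]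
  field_simp
  ring
end
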